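/- arXiv:1505.05548 — 4 statements merged into one kernel-verified Lean document; each statement's English description precedes it below -/
import Mathlib

section
/- Suppose q ∈ C^∞(ℝ) is strictly positive, x(t) = ∫₀^t √(q(u)) du is a diffeomorphism of ℝ with inverse t(x), and the function p(x) = 2{t,x} (twice the Schwarzian derivative of t with respect to x) belongs to the Schwartz space S(ℝ). Suppose there exist positive real numbers λ, Γ, μ with λ > 2·max{1/μ, Γ} and |p̂(ξ)| ≤ Γ·exp(−μ|ξ|) for all ξ ∈ ℝ. Then there exist functions σ and ν in S(ℝ) such that σ(x) = S[T[σ]](x) + p(x) + ν(x) for all x ∈ ℝ, |σ̂(ξ)| ≤ (1 + 2Γ/λ)·Γ·exp(−μ|ξ|) for all |ξ| ≤ √2·λ, σ̂(ξ) = 0 for all |ξ| > √2·λ, and ‖ν‖_∞ ≤ (Γ/(2μ))·(1 + 4Γ/λ)·exp(−μλ). -/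
open MeasureTheory Filter

noncomputable section

/-- The Fourier transform `f̂(ξ) = ∫ exp(−i x ξ) f(x) dx` of a real-valued function. -/
def FT (f : ℝ → ℝ) (ξ : ℝ) : ℂ :=
  ∫ x : ℝ, Complex.exp (-(Complex.I * (x:ℂ) * (ξ:ℂ))) * (f x : ℂ)

/-- Convolution of two complex-valued functions on `ℝ`. -/
def conv (f g : ℝ → ℂ) (ξ : ℝ) : ℂ := ∫ η : ℝ, f (ξ - η) * g η

/-- `convIter ψ n = ψ^{*(n+1)}`, the `(n+1)`-fold convolution of `ψ` with itself. -/
def convIter (ψ : ℝ → ℂ) : ℕ → ℝ → ℂ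
  | 0 => ψ
  | n + 1 => conv (convIter ψ n) ψ

/-- `exp₁*[ψ](ξ) = Σ_{n=1}^∞ ψ^{*n}(ξ)/(n!·(2π)^{n−1})`. -/
def exp1star (ψ : ℝ → ℂ) (ξ : ℝ) : ℂ :=
  ∑' n : ℕ, convIter ψ n ξ / ((Nat.factorial (n + 1) : ℂ) * ((2 * Real.pi : ℝ) : ℂ) ^ n)

/-- `exp₂*[ψ](ξ) = Σ_{n=2}^∞ ψ^{*n}(ξ)/(n!·(2π)^{n−1})`. -/
def exp2star (ψ : ℝ → ℂ) (ξ : ℝ) : ℂ :=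
  ∑' n : ℕ, convIter ψ (n + 1) ξ / ((Nat.factorial (n + 2) : ℂ) * ((2 * Real.pi : ℝ) : ℂ) ^ (n + 1))

/-- `W_b[f](ξ) = f(ξ)·b̂(ξ)/(4λ² − ξ²)`. -/
def Wb (lam : ℝ) (b : ℝ → ℝ) (f : ℝ → ℂ) (ξ : ℝ) : ℂ :=
  f ξ * ((b ξ : ℝ) : ℂ) / (((4 * lam ^ 2 - ξ ^ 2 : ℝ)) : ℂ)

/-- `W̃_b[f](ξ) = −iξ·f(ξ)·b̂(ξ)/(4λ² − ξ²)`. -/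
def Wtb (lam : ℝ) (b : ℝ → ℝ) (f : ℝ → ℂ) (ξ : ℝ) : ℂ :=
  -(Complex.I * (ξ:ℂ)) * f ξ * ((b ξ : ℝ) : ℂ) / (((4 * lam ^ 2 - ξ ^ 2 : ℝ)) : ℂ)

/-- The nonlinear operator
`R[f](ξ) = (1/(8π))·(W̃_b[f] * W̃_b[f])(ξ) − 4λ²·exp₂*[W_b[f]](ξ) + w(ξ)`. -/
def Rop (lam : ℝ) (b : ℝ → ℝ) (w : ℝ → ℂ) (f : ℝ → ℂ) (ξ : ℝ) : ℂ :=
  ((1 / (8 * Real.pi) : ℝ) : ℂ) * conv (Wtb lam b f) (Wtb lam b f) ξ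
    - ((4 * lam ^ 2 : ℝ) : ℂ) * exp2star (Wb lam b f) ξ + w ξ

/-- The nonlinear differential operator `S[f](x) = (f′(x))²/4 − 4λ²·(exp(f(x)) − f(x) − 1)`. -/
def Sop (lam : ℝ) (f : ℝ → ℂ) (x : ℝ) : ℂ :=
  (deriv f x) ^ 2 / 4 - ((4 * lam ^ 2 : ℝ) : ℂ) * (Complex.exp (f x) - f x - 1)

/-- The operator `T[f](x) = (1/2π)·∫ exp(i x ξ)·f̂(ξ)/(4λ² − ξ²) dξ`. -/
def OpT (lam : ℝ) (f : ℝ → ℝ) (x : ℝ) : ℂ :=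
  ((1 / (2 * Real.pi) : ℝ) : ℂ) *
    ∫ ξ : ℝ, Complex.exp (Complex.I * (x:ℂ) * (ξ:ℂ)) * FT f ξ / (((4 * lam ^ 2 - ξ ^ 2 : ℝ)) : ℂ)

/-- The band-limited operator `T_b[f](x) = (1/2π)·∫ exp(i x ξ)·f̂(ξ)·b̂(ξ)/(4λ² − ξ²) dξ`,
so that `T_b[f]^(ξ) = f̂(ξ)·b̂(ξ)/(4λ² − ξ²)`. -/
def Tb (lam : ℝ) (b : ℝ → ℝ) (f : ℝ → ℝ) (x : ℝ) : ℂ :=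
  ((1 / (2 * Real.pi) : ℝ) : ℂ) *
    ∫ ξ : ℝ, Complex.exp (Complex.I * (x:ℂ) * (ξ:ℂ)) * FT f ξ * ((b ξ : ℝ) : ℂ) /
      (((4 * lam ^ 2 - ξ ^ 2 : ℝ)) : ℂ)

/-- The Schwarzian derivative `{f, x} = f′′′(x)/f′(x) − (3/2)·(f′′(x)/f′(x))²`. -/
def schwarzian (f : ℝ → ℝ) (x : ℝ) : ℝ :=
  deriv (deriv (deriv f)) x / deriv f x - (3 / 2) * (deriv (deriv f) x / deriv f x) ^ 2

/-- A real-valued function is Schwartz if it agrees with an element of the Schwartz space. -/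
def IsSchwartz (f : ℝ → ℝ) : Prop := ∃ g : SchwartzMap ℝ ℝ, ∀ x, g x = f x

/-- The `L¹(ℝ)` norm `‖f‖₁ = ∫ |f(ξ)| dξ`. -/
def L1norm (f : ℝ → ℂ) : ℝ := ∫ ξ : ℝ, ‖f ξ‖

/-- The modified Bessel function of the second kind,
`K_ν(t) = ∫₀^∞ exp(−t·cosh(s))·cosh(νs) ds`. -/
def besselK (ν t : ℝ) : ℝ :=
  ∫ s in Set.Ioi (0 : ℝ), Real.exp (-t * Real.cosh s) * Real.cosh (ν * s)

/-- Kummer's confluent hypergeometric function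
`M(a,b,z) = Σ_{n=0}^∞ ((a)_n/(b)_n)·zⁿ/n!` with `(a)_n = Γ(a+n)/Γ(a)`. -/
def kummerM (a b z : ℝ) : ℝ :=
  ∑' n : ℕ, (Real.Gamma (a + n) / Real.Gamma a) / (Real.Gamma (b + n) / Real.Gamma b)
      * z ^ n / (Nat.factorial n : ℝ)

/-- The standing hypotheses on the bump function `b̂`: it is smooth, compactly supported,
equal to `1` on `[−λ, λ]`, takes values in `[0, 1]`, and is supported inside
`(−√2·λ, √2·λ)`. -/
def BumpHyp (lam : ℝ) (b : ℝ → ℝ) : Prop :=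
  ContDiff ℝ (⊤ : ℕ∞) b ∧ HasCompactSupport b ∧
    (∀ ξ : ℝ, |ξ| ≤ lam → b ξ = 1) ∧ (∀ ξ : ℝ, 0 ≤ b ξ ∧ b ξ ≤ 1) ∧
    tsupport b ⊆ Set.Ioo (-(Real.sqrt 2 * lam)) (Real.sqrt 2 * lam)


section FourierBounds

open scoped FourierTransform SchwartzMap ContDiff

/-- The pointwise product of two Schwartz functions. -/
def schwartzMul (f g : 𝓢(ℝ, ℂ)) : 𝓢(ℝ, ℂ) :=
  SchwartzMap.pairing (ContinuousLinearMap.mul ℂ ℂ) f g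

@[simp]
theorem schwartzMul_apply (f g : 𝓢(ℝ, ℂ)) (x : ℝ) : schwartzMul f g x = f x * g x := rfl

/-- The Fourier transform of `f` is dominated by `A * exp (-β |w|)`. -/
def FourierBound (β : ℝ) (f : 𝓢(ℝ, ℂ)) (A : ℝ) : Prop :=
  ∀ w : ℝ, ‖𝓕 f w‖ ≤ A * Real.exp (-β * |w|)

/-- The Fourier transform of `f` vanishes outside `[-R, R]`. -/
def FourierSupp (R : ℝ) (f : 𝓢(ℝ, ℂ)) : Prop := ∀ w : ℝ, R < |w| → 𝓕 f w = 0

theorem fourier_schwartzMul (f g : 𝓢(ℝ, ℂ)) (w : ℝ) :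
    𝓕 (schwartzMul f g) w = ∫ t, 𝓕 f t * 𝓕 g (w - t) := by
  have h : 𝓕⁻ (schwartzMul f g) =
      SchwartzMap.convolution (ContinuousLinearMap.mul ℂ ℂ) (𝓕⁻ f) (𝓕⁻ g) := by
    have := SchwartzMap.fourier_convolution (ContinuousLinearMap.mul ℂ ℂ) (𝓕⁻ f) (𝓕⁻ g)
    simp only [FourierTransform.fourier_fourierInv_eq] at this
    rw [schwartzMul, ← this, FourierTransform.fourierInv_fourier_eq]
  have inv_neg (k : 𝓢(ℝ, ℂ)) (t : ℝ) : 𝓕⁻ k t = 𝓕 k (-t) := by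
    rw [SchwartzMap.fourierInv_coe, SchwartzMap.fourier_coe, Real.fourierInv_eq_fourier_neg]
  have h2 := congrArg (fun k : 𝓢(ℝ, ℂ) ↦ k (-w)) h
  simp only [inv_neg, neg_neg, SchwartzMap.convolution_apply, convolution_def,
    ContinuousLinearMap.mul_apply'] at h2
  rw [h2, ← integral_neg_eq_self]
  refine integral_congr_ae (.of_forall fun t ↦ ?_)
  simp only [neg_neg]
  congr 2
  ring

theorem fourier_sub_apply (f g : 𝓢(ℝ, ℂ)) (w : ℝ) : 𝓕 (f - g) w = 𝓕 f w - 𝓕 g w := by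
  rw [sub_eq_add_neg, ← neg_one_smul ℂ g, FourierTransform.fourier_add,
    FourierTransform.fourier_smul, add_apply, smul_apply, neg_one_smul, sub_eq_add_neg]

theorem FourierBound.nonneg {β A : ℝ} {f : 𝓢(ℝ, ℂ)} (h : FourierBound β f A) : 0 ≤ A := by
  have := (norm_nonneg _).trans (h 0)
  simpa using this

theorem FourierBound.mono {β A B : ℝ} {f : 𝓢(ℝ, ℂ)} (h : FourierBound β f A) (hAB : A ≤ B) :
    FourierBound β f B := fun w ↦ (h w).trans (by gcongr)

theorem FourierBound.add {β A B : ℝ} {f g : 𝓢(ℝ, ℂ)} (hf : FourierBound β f A)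
    (hg : FourierBound β g B) : FourierBound β (f + g) (A + B) := fun w ↦ by
  rw [FourierTransform.fourier_add, add_apply, add_mul]
  exact (norm_add_le _ _).trans (add_le_add (hf w) (hg w))

theorem FourierBound.const_smul {β A : ℝ} {f : 𝓢(ℝ, ℂ)} (hf : FourierBound β f A) (c : ℂ) :
    FourierBound β (c • f) (‖c‖ * A) := fun w ↦ by
  rw [FourierTransform.fourier_smul, smul_apply, norm_smul, mul_assoc]
  gcongr
  exact hf w

theorem FourierBound.sub {β A B : ℝ} {f g : 𝓢(ℝ, ℂ)} (hf : FourierBound β f A)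
    (hg : FourierBound β g B) : FourierBound β (f - g) (A + B) := fun w ↦ by
  rw [fourier_sub_apply, add_mul]
  exact (norm_sub_le _ _).trans (add_le_add (hf w) (hg w))

theorem FourierSupp.sub {R : ℝ} {f g : 𝓢(ℝ, ℂ)} (hf : FourierSupp R f)
    (hg : FourierSupp R g) : FourierSupp R (f - g) := fun w hw ↦ by
  rw [fourier_sub_apply, hf w hw, hg w hw, sub_zero]

/-- Because `exp (-β |w - t|) * exp (-β |t|) ≤ exp (-β |w|)`, exponential decay of Fourier
transforms is inherited by products when one factor is band-limited. -/
theorem FourierBound.mul {β A B R : ℝ} (hβ : 0 ≤ β) (hR : 0 ≤ R) {f g : 𝓢(ℝ, ℂ)}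
    (hf : FourierBound β f A) (hg : FourierBound β g B) (hs : FourierSupp R f) :
    FourierBound β (schwartzMul f g) (2 * R * (A * B)) := fun w ↦ by
  have hA := hf.nonneg
  have hB := hg.nonneg
  rw [fourier_schwartzMul]
  have hsupp : ∫ t, 𝓕 f t * 𝓕 g (w - t) = ∫ t in Set.Icc (-R) R, 𝓕 f t * 𝓕 g (w - t) := by
    rw [setIntegral_eq_integral_of_forall_compl_eq_zero]
    intro t ht
    rw [hs t, zero_mul]
    by_contra! h
    exact ht (abs_le.mp h)
  rw [hsupp]
  refine (norm_setIntegral_le_of_norm_le_const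
    (C := A * B * Real.exp (-β * |w|)) (by simp) fun t _ ↦ ?_).trans (le_of_eq ?_)
  · rw [norm_mul]
    calc ‖𝓕 f t‖ * ‖𝓕 g (w - t)‖
        ≤ (A * Real.exp (-β * |t|)) * (B * Real.exp (-β * |w - t|)) :=
          mul_le_mul (hf t) (hg _) (norm_nonneg _) (by positivity)
      _ = A * B * Real.exp (-β * (|t| + |w - t|)) := by
          rw [mul_add, Real.exp_add]; ring
      _ ≤ A * B * Real.exp (-β * |w|) := by
          gcongr A * B * Real.exp ?_
          have : |w| ≤ |t| + |w - t| := by simpa using abs_add_le t (w - t)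
          nlinarith
  · simp only [Measure.real, Real.volume_Icc]
    rw [ENNReal.toReal_ofReal (by linarith)]
    ring

/-- The derivative of a Schwartz function. -/
def schwartzDeriv (f : 𝓢(ℝ, ℂ)) : 𝓢(ℝ, ℂ) := SchwartzMap.derivCLM ℂ ℂ f

theorem schwartzDeriv_sub (f g : 𝓢(ℝ, ℂ)) :
    schwartzDeriv (f - g) = schwartzDeriv f - schwartzDeriv g := map_sub _ _ _

theorem fourier_schwartzDeriv (f : 𝓢(ℝ, ℂ)) (w : ℝ) :
    𝓕 (schwartzDeriv f) w = (2 * Real.pi * Complex.I * w) * 𝓕 f w := by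
  have hd : (⇑(schwartzDeriv f) : ℝ → ℂ) = deriv f :=
    funext fun x ↦ SchwartzMap.derivCLM_apply ℂ f x
  have := Real.fourier_deriv (f := f) f.integrable f.differentiable
    (hd ▸ (schwartzDeriv f).integrable)
  rw [SchwartzMap.fourier_coe, hd, this]
  simp [SchwartzMap.fourier_coe]

theorem FourierSupp.deriv {R : ℝ} {f : 𝓢(ℝ, ℂ)} (hf : FourierSupp R f) :
    FourierSupp R (schwartzDeriv f) := fun w hw ↦ by
  rw [fourier_schwartzDeriv, hf w hw, mul_zero]

theorem FourierBound.deriv {β A R : ℝ} (hR : 0 ≤ R) {f : 𝓢(ℝ, ℂ)} (hf : FourierBound β f A)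
    (hs : FourierSupp R f) : FourierBound β (schwartzDeriv f) (2 * Real.pi * R * A) := fun w ↦ by
  have hA := hf.nonneg
  have hπ := Real.pi_pos
  by_cases hw : R < |w|
  · rw [hs.deriv w hw, norm_zero]; positivity
  · rw [fourier_schwartzDeriv, norm_mul, mul_assoc (2 * Real.pi * R)]
    refine mul_le_mul ?_ (hf w) (norm_nonneg _) (by positivity)
    simp only [norm_mul, Complex.norm_I, Complex.norm_real, Real.norm_eq_abs, abs_of_pos hπ,
      Complex.norm_ofNat, mul_one]
    gcongr
    exact not_lt.mp hw


theorem ContDiff.hasTemperateGrowth_comp {g : ℝ → ℂ} {h : ℂ → ℂ} (hh : ContDiff ℝ ∞ h)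
    (hg : g.HasTemperateGrowth) {M : ℝ} (hM : 0 < M) (hgM : ∀ x, ‖g x‖ ≤ M) :
    (h ∘ g).HasTemperateGrowth := by
  have hu : UniqueDiffOn ℝ (Metric.closedBall (0 : ℂ) M) :=
    uniqueDiffOn_convex (convex_closedBall _ _)
      ⟨0, by rw [interior_closedBall _ hM.ne']; simpa using hM⟩
  refine hg.comp' (t := Metric.closedBall 0 M) ?_ hu hh.contDiffOn fun N ↦ ?_
  · rintro _ ⟨x, rfl⟩
    simpa using hgM x
  · have hb (n : ℕ) : ∃ C, ∀ x ∈ Metric.closedBall (0 : ℂ) M,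
        ‖iteratedFDerivWithin ℝ n h (Metric.closedBall 0 M) x‖ ≤ C :=
      (isCompact_closedBall _ _).exists_bound_of_continuousOn
        (hh.contDiffOn.continuousOn_iteratedFDerivWithin (mod_cast le_top) hu)
    choose C hC using hb
    refine ⟨0, ∑ i ∈ Finset.range (N + 1), |C i|, by positivity, fun n hn x hx ↦ ?_⟩
    rw [pow_zero, mul_one]
    exact (hC n x hx).trans ((le_abs_self _).trans
      (Finset.single_le_sum (f := fun i ↦ |C i|) (fun _ _ ↦ abs_nonneg _)
        (by simpa using Nat.lt_succ_of_le hn)))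

theorem contDiff_dslope_cexp : ContDiff ℝ ∞ (dslope Complex.exp 0) := by
  have h : DifferentiableOn ℂ (dslope Complex.exp 0) Set.univ :=
    (Complex.differentiableOn_dslope Filter.univ_mem).2 Complex.differentiable_exp.differentiableOn
  exact ((differentiableOn_univ.1 h).contDiff).restrict_scalars ℝ

theorem SchwartzMap.exists_norm_le (f : 𝓢(ℝ, ℂ)) : ∃ M, 0 < M ∧ ∀ x, ‖f x‖ ≤ M :=
  ⟨SchwartzMap.seminorm ℝ 0 0 f + 1, by positivity,
    fun x ↦ (SchwartzMap.norm_le_seminorm ℝ f x).trans (by linarith)⟩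

/-- The Schwartz function `exp f - f - 1`. -/
def schwartzExp (f : 𝓢(ℝ, ℂ)) : 𝓢(ℝ, ℂ) :=
  SchwartzMap.smulLeftCLM ℂ (dslope Complex.exp 0 ∘ f) f - f

theorem schwartzExp_apply (f : 𝓢(ℝ, ℂ)) (x : ℝ) :
    schwartzExp f x = Complex.exp (f x) - f x - 1 := by
  obtain ⟨M, hM, hf⟩ := f.exists_norm_le
  have h := contDiff_dslope_cexp.hasTemperateGrowth_comp f.hasTemperateGrowth hM hf
  have h2 := sub_smul_dslope Complex.exp 0 (f x)
  simp only [sub_zero, smul_eq_mul, Complex.exp_zero] at h2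
  rw [schwartzExp, sub_apply, SchwartzMap.smulLeftCLM_apply_apply h, Function.comp_apply,
    smul_eq_mul, mul_comm, h2]
  ring

/-- The power `f ^ (n + 1)` of a Schwartz function. -/
def schwartzPow (f : 𝓢(ℝ, ℂ)) : ℕ → 𝓢(ℝ, ℂ)
  | 0 => f
  | n + 1 => schwartzMul f (schwartzPow f n)

theorem schwartzPow_apply (f : 𝓢(ℝ, ℂ)) (n : ℕ) (x : ℝ) : schwartzPow f n x = f x ^ (n + 1) := by
  induction n with
  | zero => simp [schwartzPow]
  | succ n ih => rw [schwartzPow, schwartzMul_apply, ih]; ring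

theorem hasSum_exp_sub_sub_one {𝕜 : Type*} [RCLike 𝕜] (z : 𝕜) :
    HasSum (fun n : ℕ ↦ z ^ (n + 2) / ((n + 2).factorial : 𝕜)) (NormedSpace.exp z - z - 1) := by
  have h := NormedSpace.expSeries_div_hasSum_exp z
  rw [← hasSum_nat_add_iff' 2] at h
  simpa [Finset.sum_range_succ, sub_sub, add_comm] using h

theorem hasSum_fourier_schwartzExp (f : 𝓢(ℝ, ℂ)) (w : ℝ) :
    HasSum (fun n : ℕ ↦ 𝓕 (schwartzPow f (n + 1)) w / ((n + 2).factorial : ℂ))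
      (𝓕 (schwartzExp f) w) := by
  obtain ⟨M, hM, hf⟩ := f.exists_norm_le
  have fourier_eq (g : 𝓢(ℝ, ℂ)) : 𝓕 g w = ∫ v : ℝ, Real.fourierChar (-(v * w)) • g v := by
    rw [SchwartzMap.fourier_coe, Real.fourier_real_eq]
  simp only [fourier_eq, ← integral_div]
  refine hasSum_integral_of_dominated_convergence
    (fun n x ↦ ‖f x‖ * (M ^ (n + 1) / (n + 1).factorial)) (fun n ↦ ?_) (fun n ↦ ?_) ?_ ?_ ?_
  · have := (schwartzPow f (n + 1)).continuous
    fun_prop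
  · refine .of_forall fun x ↦ ?_
    rw [norm_div, Circle.norm_smul, schwartzPow_apply, norm_pow, Complex.norm_natCast, pow_succ',
      mul_div_assoc]
    gcongr
    · exact hf x
    · omega
  · refine .of_forall fun x ↦ ?_
    exact (((summable_nat_add_iff 1).2 (Real.summable_pow_div_factorial M))).mul_left _
  · simp_rw [tsum_mul_left]
    exact (f.integrable.norm).mul_const _
  · refine .of_forall fun x ↦ ?_
    simp only [schwartzPow_apply, schwartzExp_apply, Circle.smul_def, smul_eq_mul, mul_div_assoc]
    rw [Complex.exp_eq_exp_ℂ]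
    exact (hasSum_exp_sub_sub_one (f x)).mul_left _

theorem FourierBound.schwartzPow {β κ s R : ℝ} (hβ : 0 ≤ β) (hR : 0 ≤ R) (hκ : 0 < κ)
    (hRκ : 2 * R ≤ κ) {f : 𝓢(ℝ, ℂ)} (hf : FourierBound β f (s / κ)) (hs : FourierSupp R f)
    (n : ℕ) : FourierBound β (schwartzPow f n) (s ^ (n + 1) / κ) := by
  induction n with
  | zero => simpa [_root_.schwartzPow] using hf
  | succ n ih =>
    refine (hf.mul hβ hR ih hs).mono ?_
    have := mul_nonneg hf.nonneg ih.nonneg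
    calc 2 * R * (s / κ * (s ^ (n + 1) / κ)) ≤ κ * (s / κ * (s ^ (n + 1) / κ)) := by gcongr
      _ = s ^ (n + 1 + 1) / κ := by rw [pow_succ' s (n + 1)]; field_simp

theorem FourierBound.schwartzPow_sub {β κ s d R : ℝ} (hβ : 0 ≤ β) (hR : 0 ≤ R) (hκ : 0 < κ)
    (hRκ : 2 * R ≤ κ) {f g : 𝓢(ℝ, ℂ)} (hf : FourierBound β f (s / κ))
    (hg : FourierBound β g (s / κ)) (hfg : FourierBound β (f - g) (d / κ))
    (hsf : FourierSupp R f) (hsg : FourierSupp R g) (n : ℕ) :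
    FourierBound β (_root_.schwartzPow f n - _root_.schwartzPow g n)
      ((n + 1) * s ^ n * d / κ) := by
  induction n with
  | zero => simpa [_root_.schwartzPow] using hfg
  | succ n ih =>
    have e : _root_.schwartzPow f (n + 1) - _root_.schwartzPow g (n + 1) =
        schwartzMul (f - g) (_root_.schwartzPow f n) +
          schwartzMul g (_root_.schwartzPow f n - _root_.schwartzPow g n) := by
      ext x
      simp only [_root_.schwartzPow, sub_apply, add_apply, schwartzMul_apply]
      ring
    have hp := hf.schwartzPow hβ hR hκ hRκ hsf n
    rw [e]
    refine ((hfg.mul hβ hR hp (hsf.sub hsg)).add (hg.mul hβ hR ih hsg)).mono ?_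
    have h1 := mul_nonneg hfg.nonneg hp.nonneg
    have h2 := mul_nonneg hg.nonneg ih.nonneg
    calc _ ≤ κ * (d / κ * (s ^ (n + 1) / κ)) + κ * (s / κ * ((n + 1) * s ^ n * d / κ)) := by gcongr
      _ = _ := by push_cast; field_simp; ring

theorem FourierBound.schwartzExp {β κ s R : ℝ} (hβ : 0 ≤ β) (hR : 0 ≤ R) (hκ : 0 < κ)
    (hRκ : 2 * R ≤ κ) {f : 𝓢(ℝ, ℂ)} (hf : FourierBound β f (s / κ)) (hs : FourierSupp R f) :
    FourierBound β (schwartzExp f) ((Real.exp s - s - 1) / κ) := fun w ↦ by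
  have h := (hasSum_exp_sub_sub_one s).mul_right (Real.exp (-β * |w|) / κ)
  rw [← Real.exp_eq_exp_ℝ] at h
  refine ((hasSum_fourier_schwartzExp f w).norm_le_of_bounded h fun n ↦ ?_).trans
    (le_of_eq (by ring))
  rw [norm_div, Complex.norm_natCast]
  calc _ ≤ s ^ (n + 1 + 1) / κ * Real.exp (-β * |w|) / ((n + 2).factorial : ℝ) := by
        gcongr
        exact hf.schwartzPow hβ hR hκ hRκ hs (n + 1) w
    _ = _ := by ring

theorem FourierBound.schwartzExp_sub {β κ s d R : ℝ} (hβ : 0 ≤ β) (hR : 0 ≤ R) (hκ : 0 < κ)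
    (hRκ : 2 * R ≤ κ) {f g : 𝓢(ℝ, ℂ)} (hf : FourierBound β f (s / κ))
    (hg : FourierBound β g (s / κ)) (hfg : FourierBound β (f - g) (d / κ))
    (hsf : FourierSupp R f) (hsg : FourierSupp R g) :
    FourierBound β (_root_.schwartzExp f - _root_.schwartzExp g)
      ((Real.exp s - 1) * d / κ) := fun w ↦ by
  have h0 := NormedSpace.expSeries_div_hasSum_exp s
  rw [← hasSum_nat_add_iff' 1, ← Real.exp_eq_exp_ℝ] at h0
  have h := h0.mul_right (d / κ * Real.exp (-β * |w|))
  rw [fourier_sub_apply]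
  refine (((hasSum_fourier_schwartzExp f w).sub
    (hasSum_fourier_schwartzExp g w)).norm_le_of_bounded h fun n ↦ ?_).trans
    (le_of_eq (by simp; ring))
  rw [← sub_div, ← fourier_sub_apply, norm_div, Complex.norm_natCast]
  calc _ ≤ ((n + 1 : ℕ) + 1) * s ^ (n + 1) * d / κ * Real.exp (-β * |w|)
        / ((n + 2).factorial : ℝ) := by
        gcongr
        exact hf.schwartzPow_sub hβ hR hκ hRκ hg hfg hsf hsg (n + 1) w
    _ = _ := by
        rw [Nat.factorial_succ (n + 1)]
        push_cast
        have : ((n : ℝ) + 1 + 1) ≠ 0 := by positivity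
        field_simp

/-- The Fourier multiplier operator with real symbol `g`. -/
def schwartzMultiplier (g : ℝ → ℝ) (f : 𝓢(ℝ, ℂ)) : 𝓢(ℝ, ℂ) :=
  SchwartzMap.fourierMultiplierCLM ℂ g f

theorem fourier_schwartzMultiplier {g : ℝ → ℝ} (hg : g.HasTemperateGrowth) (f : 𝓢(ℝ, ℂ)) (w : ℝ) :
    𝓕 (schwartzMultiplier g f) w = g w * 𝓕 f w := by
  rw [schwartzMultiplier, SchwartzMap.fourierMultiplierCLM_apply,
    FourierTransform.fourier_fourierInv_eq, SchwartzMap.smulLeftCLM_apply_apply hg,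
    Complex.real_smul]

theorem schwartzMultiplier_apply {g : ℝ → ℝ} (hg : g.HasTemperateGrowth) (f : 𝓢(ℝ, ℂ)) (x : ℝ) :
    schwartzMultiplier g f x = ∫ w : ℝ, Real.fourierChar (w * x) • (g w * 𝓕 f w) := by
  rw [schwartzMultiplier, SchwartzMap.fourierMultiplierCLM_apply, SchwartzMap.fourierInv_coe,
    Real.fourierInv_eq]
  refine integral_congr_ae (.of_forall fun w ↦ ?_)
  beta_reduce
  rw [SchwartzMap.smulLeftCLM_apply_apply hg, Complex.real_smul,
    show inner ℝ w x = w * x by simp [mul_comm]]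

theorem schwartzMultiplier_sub (g : ℝ → ℝ) (f₁ f₂ : 𝓢(ℝ, ℂ)) :
    schwartzMultiplier g (f₁ - f₂) = schwartzMultiplier g f₁ - schwartzMultiplier g f₂ :=
  map_sub _ _ _

theorem FourierSupp.multiplier {g : ℝ → ℝ} (hg : g.HasTemperateGrowth) {R : ℝ}
    (hgR : ∀ w, R < |w| → g w = 0) (f : 𝓢(ℝ, ℂ)) : FourierSupp R (schwartzMultiplier g f) :=
  fun w hw ↦ by rw [fourier_schwartzMultiplier hg, hgR w hw, Complex.ofReal_zero, zero_mul]

theorem FourierBound.multiplier {g : ℝ → ℝ} (hg : g.HasTemperateGrowth) {G β A : ℝ} (hG : 0 ≤ G)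
    (hgG : ∀ w, |g w| ≤ G) {f : 𝓢(ℝ, ℂ)} (hf : FourierBound β f A) :
    FourierBound β (schwartzMultiplier g f) (G * A) := fun w ↦ by
  rw [fourier_schwartzMultiplier hg, norm_mul, Complex.norm_real, Real.norm_eq_abs, mul_assoc]
  exact mul_le_mul (hgG w) (hf w) (norm_nonneg _) hG

/-- A complex Schwartz function with real values. -/
def RealValued (f : 𝓢(ℝ, ℂ)) : Prop := ∀ x, star (f x) = f x

theorem star_fourierChar (t : ℝ) :
    star ((Real.fourierChar t : Circle) : ℂ) = ((Real.fourierChar (-t) : Circle) : ℂ) := by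
  rw [AddChar.map_neg_eq_inv, Circle.coe_inv_eq_conj]
  rfl

theorem RealValued.star_fourier {f : 𝓢(ℝ, ℂ)} (hf : RealValued f) (w : ℝ) :
    star (𝓕 f w) = 𝓕 f (-w) := by
  rw [SchwartzMap.fourier_coe, Real.fourier_real_eq, Real.fourier_real_eq, Complex.star_def,
    ← integral_conj]
  refine integral_congr_ae (.of_forall fun v ↦ ?_)
  simp only [Circle.smul_def, smul_eq_mul, map_mul]
  rw [← Complex.star_def, star_fourierChar, hf v, mul_neg]

theorem RealValued.multiplier {g : ℝ → ℝ} (hg : g.HasTemperateGrowth) (heven : ∀ w, g (-w) = g w)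
    {f : 𝓢(ℝ, ℂ)} (hf : RealValued f) : RealValued (schwartzMultiplier g f) := fun x ↦ by
  rw [schwartzMultiplier_apply hg, Complex.star_def, ← integral_conj, ← integral_neg_eq_self]
  refine integral_congr_ae (.of_forall fun w ↦ ?_)
  simp only [Circle.smul_def, smul_eq_mul, map_mul]
  rw [← Complex.star_def, star_fourierChar, hf.star_fourier,
    heven, neg_neg, neg_mul, neg_neg, Complex.star_def, Complex.conj_ofReal]

theorem RealValued.deriv {f : 𝓢(ℝ, ℂ)} (hf : RealValued f) : RealValued (schwartzDeriv f) :=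
  fun x ↦ by
  have h := (f.hasDerivAt x).star
  rw [funext hf] at h
  exact (h.unique (f.hasDerivAt x))

theorem RealValued.sub {f g : 𝓢(ℝ, ℂ)} (hf : RealValued f) (hg : RealValued g) :
    RealValued (f - g) := fun x ↦ by rw [sub_apply, star_sub, hf, hg]

theorem RealValued.add {f g : 𝓢(ℝ, ℂ)} (hf : RealValued f) (hg : RealValued g) :
    RealValued (f + g) := fun x ↦ by rw [add_apply, star_add, hf, hg]

theorem RealValued.mul {f g : 𝓢(ℝ, ℂ)} (hf : RealValued f) (hg : RealValued g) :
    RealValued (schwartzMul f g) := fun x ↦ by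
  rw [schwartzMul_apply, star_mul', hf, hg]

theorem RealValued.smul_ofReal {f : 𝓢(ℝ, ℂ)} (hf : RealValued f) (c : ℝ) :
    RealValued ((c : ℂ) • f) := fun x ↦ by
  rw [smul_apply, star_smul, hf, Complex.star_def, Complex.conj_ofReal]

theorem RealValued.exp {f : 𝓢(ℝ, ℂ)} (hf : RealValued f) : RealValued (schwartzExp f) :=
  fun x ↦ by
  rw [schwartzExp_apply, star_sub, star_sub, hf, star_one, Complex.star_def, ← Complex.exp_conj,
    ← Complex.star_def, hf]

/-- The nonlinear operator `Sop` on Schwartz functions. -/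
def schwartzS (lam : ℝ) (u : 𝓢(ℝ, ℂ)) : 𝓢(ℝ, ℂ) :=
  ((1 / 4 : ℝ) : ℂ) • schwartzMul (schwartzDeriv u) (schwartzDeriv u) -
    ((4 * lam ^ 2 : ℝ) : ℂ) • schwartzExp u

theorem schwartzS_apply (lam : ℝ) (u : 𝓢(ℝ, ℂ)) (x : ℝ) : schwartzS lam u x = Sop lam u x := by
  have hd : schwartzDeriv u x = deriv u x := SchwartzMap.derivCLM_apply ℂ u x
  simp only [schwartzS, Sop, sub_apply, smul_apply, smul_eq_mul, schwartzMul_apply,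
    schwartzExp_apply, hd]
  push_cast
  ring

theorem RealValued.schwartzS {u : 𝓢(ℝ, ℂ)} (hu : RealValued u) (lam : ℝ) :
    RealValued (schwartzS lam u) :=
  ((hu.deriv.mul hu.deriv).smul_ofReal _).sub (hu.exp.smul_ofReal _)

theorem Real.exp_sub_self_sub_one_le {s : ℝ} (hs : 0 ≤ s) (hs1 : s ≤ 1) :
    Real.exp s - s - 1 ≤ 3 / 4 * s ^ 2 := by
  have h := (abs_le.1 (Real.exp_bound (x := s) (by rwa [abs_of_nonneg hs]) (n := 2) two_pos)).2
  simp [Finset.sum_range_succ, Nat.factorial] at h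
  linarith

/-- The data of a band-limiting Fourier multiplier of size `1 / (2 λ ^ 2)`, in the frequency
variable of Mathlib's Fourier transform. -/
structure BandMultiplier (lam R : ℝ) (g : ℝ → ℝ) : Prop where
  lam_pos : 0 < lam
  R_nonneg : 0 ≤ R
  R_le : 2 * R ≤ lam / 2
  R_sq : (2 * Real.pi * R) ^ 2 ≤ 2 * lam ^ 2
  temperate : g.HasTemperateGrowth
  le : ∀ w, |g w| ≤ 1 / (2 * lam ^ 2)
  supp : ∀ w, R < |w| → g w = 0
  even : ∀ w, g (-w) = g w

namespace BandMultiplier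

variable {lam R β C D : ℝ} {g : ℝ → ℝ} {σ τ : 𝓢(ℝ, ℂ)}

theorem fourierBound (h : BandMultiplier lam R g) (hσ : FourierBound β σ C) :
    FourierBound β (schwartzMultiplier g σ) (C / (4 * lam) / (lam / 2)) := by
  have := h.lam_pos
  refine (hσ.multiplier h.temperate (by positivity) h.le).mono (le_of_eq ?_)
  field_simp
  ring

theorem fourierBound_schwartzS (h : BandMultiplier lam R g) (hβ : 0 ≤ β)
    (hσ : FourierBound β σ C) (hC : C ≤ lam) :
    FourierBound β (schwartzS lam (schwartzMultiplier g σ)) (7 / 16 * C ^ 2 / lam) := by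
  have hl := h.lam_pos
  have hR := h.R_nonneg
  have hC0 := hσ.nonneg
  have hu := h.fourierBound hσ
  have hsu := FourierSupp.multiplier h.temperate h.supp σ
  have hd := hu.deriv hR hsu
  refine (((hd.mul hβ hR hd hsu.deriv).const_smul _).sub
    ((hu.schwartzExp hβ hR (by positivity) h.R_le hsu).const_smul _)).mono ?_
  have hs : C / (4 * lam) ≤ 1 := by rw [div_le_one (by positivity)]; linarith
  have hexp := Real.exp_sub_self_sub_one_le (s := C / (4 * lam)) (by positivity) hs
  rw [Complex.norm_of_nonneg (by norm_num), Complex.norm_of_nonneg (by positivity)]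
  calc _ = 1 / 4 * (2 * R * ((2 * Real.pi * R) ^ 2 * (C / (4 * lam) / (lam / 2)) ^ 2)) +
        4 * lam ^ 2 * ((Real.exp (C / (4 * lam)) - C / (4 * lam) - 1) / (lam / 2)) := by ring
    _ ≤ 1 / 4 * (lam / 2 * ((2 * lam ^ 2) * (C / (4 * lam) / (lam / 2)) ^ 2)) +
        4 * lam ^ 2 * ((3 / 4 * (C / (4 * lam)) ^ 2) / (lam / 2)) := by
      gcongr
      · exact h.R_le
      · exact h.R_sq
    _ = 7 / 16 * C ^ 2 / lam := by field_simp; ring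

theorem fourierBound_schwartzS_sub (h : BandMultiplier lam R g) (hβ : 0 ≤ β)
    (hσ : FourierBound β σ C) (hτ : FourierBound β τ C) (hD : FourierBound β (σ - τ) D)
    (hC : C ≤ lam) :
    FourierBound β (schwartzS lam (schwartzMultiplier g σ) -
      schwartzS lam (schwartzMultiplier g τ)) (3 / 4 * D) := by
  have hl := h.lam_pos
  have hR := h.R_nonneg
  have hC0 := hσ.nonneg
  have hD0 := hD.nonneg
  have hu := h.fourierBound hσ
  have hv := h.fourierBound hτ
  have huv := h.fourierBound hD
  rw [schwartzMultiplier_sub] at huv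
  have hsu := FourierSupp.multiplier h.temperate h.supp σ
  have hsv := FourierSupp.multiplier h.temperate h.supp τ
  have hsuv := hsu.sub hsv
  have hdu := hu.deriv hR hsu
  have hdv := hv.deriv hR hsv
  have hduv := huv.deriv hR hsuv
  set u := schwartzMultiplier g σ
  set v := schwartzMultiplier g τ
  have e : schwartzS lam u - schwartzS lam v =
      ((1 / 4 : ℝ) : ℂ) • schwartzMul (schwartzDeriv (u - v)) (schwartzDeriv u + schwartzDeriv v) -
        ((4 * lam ^ 2 : ℝ) : ℂ) • (schwartzExp u - schwartzExp v) := by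
    ext x
    simp only [schwartzS, schwartzDeriv_sub, sub_apply, add_apply, smul_apply, smul_eq_mul,
      schwartzMul_apply]
    ring
  rw [e]
  refine (((hduv.mul hβ hR (hdu.add hdv) hsuv.deriv).const_smul _).sub
    ((hu.schwartzExp_sub hβ hR (by positivity) h.R_le hv huv hsu hsv).const_smul _)).mono ?_
  have hs : C / (4 * lam) ≤ 1 / 4 := by rw [div_le_iff₀ (by positivity)]; linarith
  have hs0 : 0 ≤ C / (4 * lam) := by positivity
  have hexp := Real.exp_sub_self_sub_one_le (s := C / (4 * lam)) hs0 (by linarith)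
  have hexp' : Real.exp (C / (4 * lam)) - 1 ≤ 3 / 10 := by nlinarith
  rw [Complex.norm_of_nonneg (by norm_num), Complex.norm_of_nonneg (by positivity)]
  calc _ = 1 / 2 * (2 * R * ((2 * Real.pi * R) ^ 2 *
          (C / (4 * lam) * (D / (4 * lam) / (lam / 2) / (lam / 2))))) +
        4 * lam ^ 2 * ((Real.exp (C / (4 * lam)) - 1) * (D / (4 * lam)) / (lam / 2)) := by ring
    _ ≤ 1 / 2 * (lam / 2 * ((2 * lam ^ 2) *
          (1 / 4 * (D / (4 * lam) / (lam / 2) / (lam / 2))))) +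
        4 * lam ^ 2 * (3 / 10 * (D / (4 * lam)) / (lam / 2)) := by
      gcongr
      · exact h.R_le
      · exact h.R_sq
    _ = 29 / 40 * D := by field_simp; ring
    _ ≤ 3 / 4 * D := by linarith

/-- Picard iteration for `σ = S[u] + p`, where `u` is the Fourier multiplier `g` applied to `σ`. -/
def iterate (lam : ℝ) (g : ℝ → ℝ) (p : 𝓢(ℝ, ℂ)) : ℕ → 𝓢(ℝ, ℂ)
  | 0 => p
  | n + 1 => schwartzS lam (schwartzMultiplier g (iterate lam g p n)) + p

variable {p : 𝓢(ℝ, ℂ)} {Γ : ℝ}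

theorem realValued_iterate (h : BandMultiplier lam R g) (hp : RealValued p) (n : ℕ) :
    RealValued (iterate lam g p n) := by
  induction n with
  | zero => exact hp
  | succ n ih => exact ((ih.multiplier h.temperate h.even).schwartzS lam).add hp

theorem const_le (hlam : 0 < lam) (hΓ : 0 ≤ Γ) (hΓl : 2 * Γ ≤ lam) :
    (1 + 2 * Γ / lam) * Γ ≤ 2 * Γ := by
  gcongr
  have : 2 * Γ / lam ≤ 1 := (div_le_one hlam).2 hΓl
  linarith

theorem fourierBound_iterate (h : BandMultiplier lam R g) (hβ : 0 ≤ β) (hp : FourierBound β p Γ)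
    (hΓl : 2 * Γ ≤ lam) (n : ℕ) :
    FourierBound β (iterate lam g p n) ((1 + 2 * Γ / lam) * Γ) := by
  have hl := h.lam_pos
  have hΓ := hp.nonneg
  have hC := const_le hl hΓ hΓl
  induction n with
  | zero =>
    refine hp.mono (le_mul_of_one_le_left hΓ ?_)
    linarith [show 0 ≤ 2 * Γ / lam by positivity]
  | succ n ih =>
    refine ((h.fourierBound_schwartzS hβ ih (hC.trans hΓl)).add hp).mono ?_
    calc _ ≤ 7 / 16 * (2 * Γ) ^ 2 / lam + Γ := by gcongr
      _ = 7 / 4 * (Γ ^ 2 / lam) + Γ := by ring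
      _ ≤ 2 * (Γ ^ 2 / lam) + Γ := by gcongr; norm_num
      _ = _ := by ring

theorem fourierBound_iterate_sub (h : BandMultiplier lam R g) (hβ : 0 ≤ β)
    (hp : FourierBound β p Γ) (hΓl : 2 * Γ ≤ lam) (n : ℕ) :
    FourierBound β (iterate lam g p (n + 1) - iterate lam g p n)
      ((3 / 4) ^ n * (2 * ((1 + 2 * Γ / lam) * Γ))) := by
  have hit := h.fourierBound_iterate hβ hp hΓl
  induction n with
  | zero => exact ((hit 1).sub (hit 0)).mono (le_of_eq (by ring))
  | succ n ih =>
    have := h.fourierBound_schwartzS_sub hβ (hit (n + 1)) (hit n) ih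
      ((const_le h.lam_pos hp.nonneg hΓl).trans hΓl)
    rw [iterate, iterate, add_sub_add_right_eq_sub]
    exact this.mono (le_of_eq (by ring))

end BandMultiplier

/-- A bound for half of the `L¹` norm of an exponentially decaying function that vanishes near the
origin. -/
theorem setIntegral_norm_le_of_exp_bound {h : ℝ → ℂ} (hh : Integrable h) {A β c : ℝ} (hβ : 0 < β)
    (hc : 0 ≤ c) (h0 : ∀ w, |w| < c → h w = 0) (hb : ∀ w, ‖h w‖ ≤ A * Real.exp (-β * |w|)) :
    ∫ w in Set.Ioi 0, ‖h w‖ ≤ A * Real.exp (-β * c) / β := by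
  have e : ∫ w in Set.Ici 0, ‖h w‖ = ∫ w in Set.Ici c, ‖h w‖ := by
    refine setIntegral_eq_of_subset_of_forall_sdiff_eq_zero measurableSet_Ici
      (Set.Ici_subset_Ici.2 hc) fun w hw ↦ ?_
    rw [h0 w (by rw [abs_of_nonneg hw.1]; exact not_le.1 hw.2), norm_zero]
  rw [← integral_Ici_eq_integral_Ioi, e, integral_Ici_eq_integral_Ioi]
  have hβ' : -β < 0 := neg_neg_of_pos hβ
  calc ∫ w in Set.Ioi c, ‖h w‖ ≤ ∫ w in Set.Ioi c, A * Real.exp (-β * w) := by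
        refine setIntegral_mono_on hh.norm.integrableOn
          ((integrableOn_exp_mul_Ioi hβ' c).const_mul A) measurableSet_Ioi fun w hw ↦ ?_
        have := hb w
        rwa [abs_of_nonneg (hc.trans (le_of_lt hw))] at this
    _ = A * Real.exp (-β * c) / β := by
        rw [integral_const_mul, integral_exp_mul_Ioi hβ' c, neg_div_neg_eq, mul_div_assoc]

theorem norm_apply_le_integral_norm_fourier (f : 𝓢(ℝ, ℂ)) (x : ℝ) : ‖f x‖ ≤ ∫ w, ‖𝓕 f w‖ := by
  conv_lhs => rw [← FourierTransform.fourierInv_fourier_eq (F := 𝓢(ℝ, ℂ)) f]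
  rw [SchwartzMap.fourierInv_coe, Real.fourierInv_eq]
  refine (norm_integral_le_integral_norm _).trans (le_of_eq ?_)
  simp

/-- A sup-norm bound for a function with exponentially decaying Fourier transform that vanishes
at low frequencies. -/
theorem FourierBound.norm_apply_le {β A c : ℝ} {f : 𝓢(ℝ, ℂ)} (hf : FourierBound β f A)
    (hβ : 0 < β) (hc : 0 ≤ c) (h0 : ∀ w, |w| < c → 𝓕 f w = 0) (x : ℝ) :
    ‖f x‖ ≤ 2 * A * Real.exp (-β * c) / β := by
  have hi := (𝓕 f : 𝓢(ℝ, ℂ)).integrable (μ := volume)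
  have h₁ := setIntegral_norm_le_of_exp_bound hi hβ hc h0 hf
  have h₂ := setIntegral_norm_le_of_exp_bound (h := fun w ↦ 𝓕 f (-w)) hi.comp_neg hβ hc
    (fun w hw ↦ h0 _ (by rwa [abs_neg])) (fun w ↦ by simpa using hf (-w))
  rw [integral_comp_neg_Ioi (0 : ℝ) (fun w ↦ ‖𝓕 f w‖), neg_zero] at h₂
  refine (norm_apply_le_integral_norm_fourier f x).trans ?_
  rw [← intervalIntegral.integral_Iic_add_Ioi hi.norm.integrableOn hi.norm.integrableOn (b := 0)]
  calc _ ≤ _ := add_le_add h₂ h₁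
    _ = _ := by ring

theorem FT_eq_fourier {f : ℝ → ℝ} {s : 𝓢(ℝ, ℂ)} (h : ∀ x, s x = f x) (ξ : ℝ) :
    FT f ξ = 𝓕 s (ξ / (2 * Real.pi)) := by
  rw [FT, SchwartzMap.fourier_coe, Real.fourier_real_eq]
  refine integral_congr_ae (.of_forall fun x ↦ ?_)
  beta_reduce
  rw [h, Circle.smul_def, Real.fourierChar_apply, smul_eq_mul]
  congr 2
  push_cast
  field_simp

theorem OpT_eq_schwartzMultiplier {lam : ℝ} {g : ℝ → ℝ} (hg : g.HasTemperateGrowth) {σ : ℝ → ℝ}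
    {τ : 𝓢(ℝ, ℂ)} (h : ∀ ξ : ℝ, FT σ ξ / ((4 * lam ^ 2 - ξ ^ 2 : ℝ) : ℂ) =
      g (ξ / (2 * Real.pi)) * 𝓕 τ (ξ / (2 * Real.pi))) :
    OpT lam σ = schwartzMultiplier g τ := by
  funext x
  have hπ := Real.pi_pos
  have hc := Measure.integral_comp_div
    (fun w ↦ Real.fourierChar (w * x) • ((g w : ℂ) * 𝓕 τ w)) (2 * Real.pi)
  rw [OpT, schwartzMultiplier_apply hg]
  rw [abs_of_pos (by positivity)] at hc
  have hl : ∫ ξ : ℝ, Complex.exp (Complex.I * (x : ℂ) * (ξ : ℂ)) * FT σ ξ /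
      ((4 * lam ^ 2 - ξ ^ 2 : ℝ) : ℂ) = ∫ ξ : ℝ, Real.fourierChar (ξ / (2 * Real.pi) * x) •
        ((g (ξ / (2 * Real.pi)) : ℂ) * 𝓕 τ (ξ / (2 * Real.pi))) := by
    refine integral_congr_ae (.of_forall fun ξ ↦ ?_)
    beta_reduce
    rw [mul_div_assoc, h, Circle.smul_def, Real.fourierChar_apply, smul_eq_mul]
    congr 2
    push_cast
    field_simp
  rw [hl, hc, Complex.real_smul, ← mul_assoc, ← Complex.ofReal_mul]
  rw [one_div_mul_cancel (by positivity), Complex.ofReal_one, one_mul]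

/-- A smooth even cutoff equal to one on `[-λ, λ]` and supported in `[-√2 λ, √2 λ]`. -/
theorem exists_even_cutoff {lam : ℝ} (hlam : 0 < lam) :
    ∃ b : ℝ → ℝ, ContDiff ℝ ∞ b ∧ (∀ ξ, b (-ξ) = b ξ) ∧ (∀ ξ, |ξ| ≤ lam → b ξ = 1) ∧
      (∀ ξ, 0 ≤ b ξ) ∧ (∀ ξ, b ξ ≤ 1) ∧ ∀ ξ, Real.sqrt 2 * lam ≤ |ξ| → b ξ = 0 := by
  have h2 : 1 < Real.sqrt 2 := Real.lt_sqrt_of_sq_lt (by norm_num)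
  let b : ContDiffBump (0 : ℝ) := ⟨lam, Real.sqrt 2 * lam, hlam, by nlinarith⟩
  refine ⟨b, b.contDiff, b.neg, fun ξ hξ ↦ b.one_of_mem_closedBall (by simpa using hξ),
    fun _ ↦ b.nonneg, fun _ ↦ b.le_one, fun ξ hξ ↦ b.zero_of_le_dist (by simpa using hξ)⟩

theorem ContDiff.hasTemperateGrowth_comp_mul {h : ℝ → ℝ} (hs : ContDiff ℝ ∞ h) {M : ℝ}
    (h0 : ∀ ξ, M ≤ |ξ| → h ξ = 0) {a : ℝ} (ha : 0 < a) :
    (fun w ↦ h (a * w)).HasTemperateGrowth := by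
  refine HasCompactSupport.hasTemperateGrowth ?_ (hs.comp (contDiff_const.mul contDiff_id))
  refine HasCompactSupport.intro (isCompact_closedBall (0 : ℝ) (M / a)) fun w hw ↦ h0 _ ?_
  rw [mem_closedBall_zero_iff, not_le, Real.norm_eq_abs, div_lt_iff₀ ha] at hw
  rw [abs_mul, abs_of_pos ha, mul_comm]
  exact hw.le

theorem contDiff_div_sub_sq {lam : ℝ} (hlam : 0 < lam) {b : ℝ → ℝ} (hb : ContDiff ℝ ∞ b)
    (h0 : ∀ ξ, Real.sqrt 2 * lam ≤ |ξ| → b ξ = 0) :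
    ContDiff ℝ ∞ fun ξ ↦ b ξ / (4 * lam ^ 2 - ξ ^ 2) := by
  have h2 : Real.sqrt 2 * lam < 2 * lam := by
    gcongr
    exact (Real.sqrt_lt' two_pos).2 (by norm_num)
  refine contDiff_iff_contDiffAt.2 fun ξ ↦ ?_
  rcases lt_or_ge (Real.sqrt 2 * lam) |ξ| with hξ | hξ
  · refine (contDiffAt_const (c := (0 : ℝ))).congr_of_eventuallyEq ?_
    filter_upwards [continuous_abs.continuousAt.eventually_const_lt hξ] with η hη
    rw [h0 η hη.le, zero_div]
  · refine hb.contDiffAt.div (by fun_prop) ?_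
    have := sq_lt_sq' (by linarith [abs_nonneg ξ]) (hξ.trans_lt h2)
    rw [sq_abs] at this
    linarith

theorem bandMultiplier_of_cutoff {lam : ℝ} (hlam : 0 < lam) {b : ℝ → ℝ} (hb : ContDiff ℝ ∞ b)
    (heven : ∀ ξ, b (-ξ) = b ξ) (hb0 : ∀ ξ, 0 ≤ b ξ) (hb1 : ∀ ξ, b ξ ≤ 1)
    (h0 : ∀ ξ, Real.sqrt 2 * lam ≤ |ξ| → b ξ = 0) :
    BandMultiplier lam (Real.sqrt 2 * lam / (2 * Real.pi))
      fun w ↦ b (2 * Real.pi * w) / (4 * lam ^ 2 - (2 * Real.pi * w) ^ 2) where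
  lam_pos := hlam
  R_nonneg := by positivity
  R_le := by
    have h2 : Real.sqrt 2 ≤ 3 / 2 := Real.sqrt_le_iff.2 (by norm_num)
    rw [← mul_div_assoc, mul_div_mul_left _ _ two_ne_zero, div_le_div_iff₀ Real.pi_pos two_pos]
    nlinarith [Real.pi_gt_three]
  R_sq := by
    rw [mul_div_cancel₀ _ (by positivity), mul_pow, Real.sq_sqrt two_pos.le]
  temperate := (contDiff_div_sub_sq hlam hb h0).hasTemperateGrowth_comp_mul
    (fun ξ hξ ↦ by rw [h0 ξ hξ, zero_div]) Real.two_pi_pos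
  le w := by
    rcases le_or_gt (Real.sqrt 2 * lam) |2 * Real.pi * w| with h | h
    · rw [h0 _ h, zero_div, abs_zero]
      positivity
    · have hsq := sq_lt_sq' (by linarith [abs_nonneg (2 * Real.pi * w)]) h
      rw [sq_abs, mul_pow (Real.sqrt 2), Real.sq_sqrt two_pos.le] at hsq
      rw [abs_of_nonneg (div_nonneg (hb0 _) (by nlinarith))]
      exact div_le_div₀ zero_le_one (hb1 _) (by positivity) (by linarith)
  supp w hw := by
    rw [div_lt_iff₀ Real.two_pi_pos] at hw
    rw [h0, zero_div]
    rw [abs_mul, abs_of_pos Real.two_pi_pos, mul_comm (2 * Real.pi)]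
    exact hw.le
  even w := by rw [mul_neg, heven, neg_sq]

theorem RealValued.ofReal_re {f : 𝓢(ℝ, ℂ)} (hf : RealValued f) (x : ℝ) :
    ((f x).re : ℂ) = f x := Complex.conj_eq_iff_re.1 (hf x)

theorem isSchwartz_re (f : 𝓢(ℝ, ℂ)) : IsSchwartz fun x ↦ (f x).re :=
  ⟨f.postcompCLM Complex.reCLM, fun _ ↦ rfl⟩

end FourierBounds

/-- Theorem 4.1 / `main_theorem`: existence of nonoscillatory phase
functions in the Schwartz class with band-limited Fourier transform. -/
theorem stmt_0
    (q : ℝ → ℝ) (hq_smooth : ContDiff ℝ (⊤ : ℕ∞) q) (hq_pos : ∀ t : ℝ, 0 < q t)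
    (X tX : ℝ → ℝ)
    (hX : ∀ t : ℝ, X t = ∫ u in (0:ℝ)..t, Real.sqrt (q u))
    (hX_smooth : ContDiff ℝ (⊤ : ℕ∞) X) (hX_bij : Function.Bijective X)
    (htX_left : Function.LeftInverse tX X) (htX_right : Function.RightInverse tX X)
    (p : ℝ → ℝ) (hp : ∀ x : ℝ, p x = 2 * schwarzian tX x)
    (hp_schwartz : IsSchwartz p)
    (lam Γ μ : ℝ) (hΓ : 0 < Γ) (hμ : 0 < μ) (hlam_pos : 0 < lam)
    (hlam : lam > 2 * max (1 / μ) Γ)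
    (hphat : ∀ ξ : ℝ, ‖FT p ξ‖ ≤ Γ * Real.exp (-μ * |ξ|)) :
    ∃ σ ν : ℝ → ℝ, IsSchwartz σ ∧ IsSchwartz ν ∧
      (∀ x : ℝ, (σ x : ℂ) = Sop lam (OpT lam σ) x + (p x : ℂ) + (ν x : ℂ)) ∧
      (∀ ξ : ℝ, |ξ| ≤ Real.sqrt 2 * lam →
        ‖FT σ ξ‖ ≤ (1 + 2 * Γ / lam) * Γ * Real.exp (-μ * |ξ|)) ∧
      (∀ ξ : ℝ, |ξ| > Real.sqrt 2 * lam → FT σ ξ = 0) ∧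
      (∀ t : ℝ, |ν t| ≤ (Γ / (2 * μ)) * (1 + 4 * Γ / lam) * Real.exp (-μ * lam)) := by
  open scoped FourierTransform SchwartzMap in
  have hπ := Real.pi_pos
  obtain ⟨P₀, hP₀⟩ := hp_schwartz
  let P : 𝓢(ℝ, ℂ) := P₀.postcompCLM Complex.ofRealCLM
  have hP (x : ℝ) : P x = p x := congrArg Complex.ofReal (hP₀ x)
  have hPreal : RealValued P := fun x ↦ by rw [hP]; exact Complex.conj_ofReal _
  have hβ : 0 < 2 * Real.pi * μ := by positivity
  have hPb : FourierBound (2 * Real.pi * μ) P Γ := fun w ↦ by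
    have := hphat (2 * Real.pi * w)
    rw [FT_eq_fourier hP, mul_div_cancel_left₀ _ Real.two_pi_pos.ne', abs_mul,
      abs_of_pos Real.two_pi_pos] at this
    refine this.trans (le_of_eq ?_)
    ring_nf
  have hΓl : 2 * Γ ≤ lam := by linarith [le_max_right (1 / μ) Γ]
  obtain ⟨b, hbs, heven, hb_one, hb0, hb1, hbz⟩ := exists_even_cutoff hlam_pos
  have hB := bandMultiplier_of_cutoff hlam_pos hbs heven hb0 hb1 hbz
  set g : ℝ → ℝ := fun w ↦ b (2 * Real.pi * w) / (4 * lam ^ 2 - (2 * Real.pi * w) ^ 2) with hg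
  set C := (1 + 2 * Γ / lam) * Γ with hC
  have hC0 : 0 < C := by positivity
  obtain ⟨n, hn⟩ : ∃ n : ℕ, (3 / 4 : ℝ) ^ n * (2 * C) < Γ / 2 * Real.exp (-μ * lam) := by
    obtain ⟨n, hn⟩ := exists_pow_lt_of_lt_one
      (show 0 < Γ / 2 * Real.exp (-μ * lam) / (2 * C) by positivity)
      (show (3 / 4 : ℝ) < 1 by norm_num)
    exact ⟨n, (lt_div_iff₀ (by positivity)).1 hn⟩
  set τ := BandMultiplier.iterate lam g P n with hτ
  set τ' := BandMultiplier.iterate lam g P (n + 1) with hτ'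
  have hτb : FourierBound (2 * Real.pi * μ) τ C := hB.fourierBound_iterate hβ.le hPb hΓl n
  have hgb : (fun w ↦ b (2 * Real.pi * w)).HasTemperateGrowth :=
    hbs.hasTemperateGrowth_comp_mul hbz Real.two_pi_pos
  set s := schwartzMultiplier (fun w ↦ b (2 * Real.pi * w)) τ with hs
  have hτreal : RealValued τ := hB.realValued_iterate hPreal n
  have hsreal : RealValued s :=
    hτreal.multiplier hgb fun w ↦ by rw [mul_neg, heven]
  have hνreal : RealValued (s - τ') := hsreal.sub (hB.realValued_iterate hPreal (n + 1))
  have hFT (ξ : ℝ) : FT (fun x ↦ (s x).re) ξ = b ξ * 𝓕 τ (ξ / (2 * Real.pi)) := by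
    rw [FT_eq_fourier (s := s) fun x ↦ (hsreal.ofReal_re x).symm, hs,
      fourier_schwartzMultiplier hgb, mul_div_cancel₀ _ Real.two_pi_pos.ne']
  have hT : OpT lam (fun x ↦ (s x).re) = schwartzMultiplier g τ := by
    refine OpT_eq_schwartzMultiplier hB.temperate fun ξ ↦ ?_
    rw [hFT, hg]
    beta_reduce
    rw [mul_div_cancel₀ _ Real.two_pi_pos.ne', Complex.ofReal_div]
    ring
  refine ⟨fun x ↦ (s x).re, fun x ↦ ((s - τ') x).re, isSchwartz_re s, isSchwartz_re _,
    fun x ↦ ?_, fun ξ _ ↦ ?_, fun ξ hξ ↦ ?_, fun t ↦ ?_⟩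
  · rw [hνreal.ofReal_re, hsreal.ofReal_re, hT, ← schwartzS_apply, ← hP, sub_apply, hτ',
      BandMultiplier.iterate, add_apply]
    ring
  · rw [hFT, norm_mul, Complex.norm_of_nonneg (hb0 ξ)]
    refine (mul_le_of_le_one_left (norm_nonneg _) (hb1 ξ)).trans ((hτb _).trans (le_of_eq ?_))
    rw [abs_div, abs_of_pos Real.two_pi_pos]
    congr 2
    field_simp
  · rw [hFT, hbz ξ hξ.le, Complex.ofReal_zero, zero_mul]
  · have hsτ : FourierBound (2 * Real.pi * μ) (s - τ) C := fun w ↦ by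
      rw [fourier_sub_apply, hs, fourier_schwartzMultiplier hgb, ← sub_one_mul, norm_mul,
        ← Complex.ofReal_one, ← Complex.ofReal_sub, Complex.norm_real, Real.norm_eq_abs]
      refine (mul_le_of_le_one_left (norm_nonneg _) (abs_le.2 ⟨?_, ?_⟩)).trans (hτb w)
      · linarith [hb0 (2 * Real.pi * w)]
      · linarith [hb1 (2 * Real.pi * w)]
    have h₁ := hsτ.norm_apply_le hβ (c := lam / (2 * Real.pi)) (by positivity) (fun w hw ↦ by
      rw [lt_div_iff₀ Real.two_pi_pos] at hw
      rw [fourier_sub_apply, hs, fourier_schwartzMultiplier hgb, hb_one, Complex.ofReal_one,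
        one_mul, sub_self]
      rw [abs_mul, abs_of_pos Real.two_pi_pos, mul_comm]
      exact hw.le) t
    have h₂ := (hB.fourierBound_iterate_sub hβ.le hPb hΓl n).norm_apply_le hβ le_rfl
      (fun w hw ↦ absurd hw (abs_nonneg w).not_gt) t
    rw [mul_zero, Real.exp_zero, mul_one] at h₂
    rw [show -(2 * Real.pi * μ) * (lam / (2 * Real.pi)) = -μ * lam by field_simp] at h₁
    set E := Real.exp (-μ * lam)
    have hE : 0 < E := Real.exp_pos _
    calc |((s - τ') t).re| ≤ ‖(s - τ') t‖ := Complex.abs_re_le_norm _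
      _ = ‖(s - τ) t - (τ' - τ) t‖ := by
        congr 1
        simp only [sub_apply]
        ring
      _ ≤ ‖(s - τ) t‖ + ‖(τ' - τ) t‖ := norm_sub_le _ _
      _ ≤ 2 * C * E / (2 * Real.pi * μ) + 2 * (Γ / 2 * E) / (2 * Real.pi * μ) := by
        refine add_le_add h₁ (h₂.trans ?_)
        gcongr
      _ = (C * E + Γ / 2 * E) / (μ * Real.pi) := by field_simp
      _ ≤ (C * E + Γ / 2 * E) / (μ * 3) := by
        gcongr
        exact Real.pi_gt_three.le
      _ = Γ / (2 * μ) * (1 + 4 / 3 * Γ / lam) * E := by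
        rw [hC]
        field_simp
        ring
      _ ≤ _ := by
        gcongr
        norm_num

end
end

section
/- Suppose λ > 0 is a real number and w ∈ L¹(ℝ) satisfies ‖w‖₁ ≤ (π/2)·λ². Define the sequence ψ₀ = w and ψ_{n+1} = R[ψ_n] for n ≥ 0. Then the sequence {ψ_n} converges in L¹(ℝ) norm to a function ψ ∈ L¹(ℝ) which satisfies ψ(ξ) = R[ψ](ξ) for almost every ξ ∈ ℝ. -/
open MeasureTheory Filter

noncomputable section

lemma L1norm_nonneg (f : ℝ → ℂ) : 0 ≤ L1norm f := integral_nonneg fun _ => norm_nonneg _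

lemma L1norm_congr {f g : ℝ → ℂ} (h : f =ᵐ[volume] g) : L1norm f = L1norm g :=
  integral_congr_ae (h.fun_comp norm)

lemma L1norm_add_le {f g : ℝ → ℂ} (hf : Integrable f) (hg : Integrable g) :
    L1norm (f + g) ≤ L1norm f + L1norm g := by
  unfold L1norm
  rw [← integral_add hf.norm hg.norm]
  exact integral_mono (hf.add hg).norm (hf.norm.add hg.norm) fun _ => norm_add_le _ _

lemma L1norm_sub_le {f g : ℝ → ℂ} (hf : Integrable f) (hg : Integrable g) :
    L1norm (f - g) ≤ L1norm f + L1norm g := by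
  unfold L1norm
  rw [← integral_add hf.norm hg.norm]
  exact integral_mono (hf.sub hg).norm (hf.norm.add hg.norm) fun _ => norm_sub_le _ _

lemma L1norm_const_mul (c : ℂ) (f : ℝ → ℂ) : L1norm (fun x => c * f x) = ‖c‖ * L1norm f := by
  simp only [L1norm, norm_mul, integral_const_mul]

lemma L1norm_div_const (f : ℝ → ℂ) (c : ℂ) : L1norm (fun x => f x / c) = L1norm f / ‖c‖ := by
  simp only [L1norm, norm_div, integral_div]

lemma L1norm_mul_le {f m : ℝ → ℂ} {C : ℝ} (hf : Integrable f) (hm : ∀ x, ‖m x‖ ≤ C) :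
    L1norm (fun x => m x * f x) ≤ C * L1norm f := by
  unfold L1norm
  rw [← integral_const_mul]
  refine integral_mono_of_nonneg (Eventually.of_forall fun _ => norm_nonneg _)
    (hf.norm.const_mul C) (Eventually.of_forall fun x => ?_)
  simp only [norm_mul]
  gcongr
  exact hm x

lemma conv_congr {f f' g g' : ℝ → ℂ} (hf : f =ᵐ[volume] f') (hg : g =ᵐ[volume] g') :
    conv f g = conv f' g' := by
  ext ξ
  refine integral_congr_ae ?_
  have h := (quasiMeasurePreserving_sub_left_of_right_invariant volume ξ).ae_eq_comp hf
  filter_upwards [h, hg] with η h1 h2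
  simp only [Function.comp_apply] at h1
  rw [h1, h2]

lemma integrable_conv_prod {f g : ℝ → ℂ} (hf : Integrable f) (hg : Integrable g) :
    Integrable (fun p : ℝ × ℝ => f (p.1 - p.2) * g p.2) (volume.prod volume) := by
  simpa [mul_comm] using hg.convolution_integrand (ContinuousLinearMap.mul ℝ ℂ) hf

lemma integrable_conv {f g : ℝ → ℂ} (hf : Integrable f) (hg : Integrable g) :
    Integrable (conv f g) :=
  (integrable_conv_prod hf hg).integral_prod_left

lemma L1norm_conv_le {f g : ℝ → ℂ} (hf : Integrable f) (hg : Integrable g) :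
    L1norm (conv f g) ≤ L1norm f * L1norm g := by
  have hp := (integrable_conv_prod hf hg).norm
  calc L1norm (conv f g) ≤ ∫ ξ, ∫ η, ‖f (ξ - η) * g η‖ :=
        integral_mono (integrable_conv hf hg).norm hp.integral_prod_left
          fun ξ => norm_integral_le_integral_norm _
    _ = ∫ η, ∫ ξ, ‖f (ξ - η) * g η‖ := integral_integral_swap hp
    _ = L1norm f * L1norm g := by
        simp only [norm_mul, integral_mul_const, integral_sub_right_eq_self (‖f ·‖),
          integral_const_mul, L1norm]

lemma conv_sub_conv_ae {f f' g g' : ℝ → ℂ} (hf : Integrable f) (hf' : Integrable f')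
    (hg : Integrable g) (hg' : Integrable g') :
    conv f g - conv f' g' =ᵐ[volume] conv (f - f') g + conv f' (g - g') := by
  filter_upwards [(integrable_conv_prod hf hg).prod_right_ae,
    (integrable_conv_prod hf' hg).prod_right_ae,
    (integrable_conv_prod hf' hg').prod_right_ae] with ξ h1 h2 h3
  simp only [Pi.sub_apply, Pi.add_apply, conv, sub_mul, mul_sub]
  rw [integral_sub h1 h2, integral_sub h2 h3]
  ring

lemma L1norm_conv_sub_conv_le {f f' g g' : ℝ → ℂ} (hf : Integrable f) (hf' : Integrable f')
    (hg : Integrable g) (hg' : Integrable g') :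
    L1norm (conv f g - conv f' g') ≤
      L1norm (f - f') * L1norm g + L1norm f' * L1norm (g - g') := by
  rw [L1norm_congr (conv_sub_conv_ae hf hf' hg hg')]
  exact (L1norm_add_le (integrable_conv (hf.sub hf') hg) (integrable_conv hf' (hg.sub hg'))).trans
    (add_le_add (L1norm_conv_le (hf.sub hf') hg) (L1norm_conv_le hf' (hg.sub hg')))

lemma integrable_convIter {f : ℝ → ℂ} (hf : Integrable f) (n : ℕ) : Integrable (convIter f n) := by
  induction n with
  | zero => exact hf
  | succ n ih => exact integrable_conv ih hf

lemma convIter_congr_ae {f g : ℝ → ℂ} (h : f =ᵐ[volume] g) (n : ℕ) :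
    convIter f n =ᵐ[volume] convIter g n := by
  induction n with
  | zero => exact h
  | succ n ih => exact .of_eq (conv_congr ih h)

lemma L1norm_convIter_le {f : ℝ → ℂ} {M : ℝ} (hf : Integrable f) (hM : L1norm f ≤ M) (n : ℕ) :
    L1norm (convIter f n) ≤ M ^ (n + 1) := by
  have hM0 := (L1norm_nonneg f).trans hM
  induction n with
  | zero => simpa [convIter] using hM
  | succ n ih =>
    rw [pow_succ]
    exact (L1norm_conv_le (integrable_convIter hf n) hf).trans
      (mul_le_mul ih hM (L1norm_nonneg f) (by positivity))

lemma L1norm_convIter_sub_le {f g : ℝ → ℂ} {M : ℝ} (hf : Integrable f) (hg : Integrable g)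
    (hfM : L1norm f ≤ M) (hgM : L1norm g ≤ M) (n : ℕ) :
    L1norm (convIter f n - convIter g n) ≤ (n + 1) * M ^ n * L1norm (f - g) := by
  have hM0 := (L1norm_nonneg f).trans hfM
  have hd := L1norm_nonneg (f - g)
  induction n with
  | zero => simp [convIter]
  | succ n ih =>
    calc L1norm (convIter f (n + 1) - convIter g (n + 1))
        ≤ L1norm (convIter f n - convIter g n) * L1norm f
            + L1norm (convIter g n) * L1norm (f - g) :=
          L1norm_conv_sub_conv_le (integrable_convIter hf n) (integrable_convIter hg n) hf hg
      _ ≤ ((n + 1) * M ^ n * L1norm (f - g)) * M + M ^ (n + 1) * L1norm (f - g) := by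
          gcongr
          · exact L1norm_nonneg f
          · exact L1norm_convIter_le hg hgM n
      _ = ((n + 1 : ℕ) + 1) * M ^ (n + 1) * L1norm (f - g) := by push_cast; ring

/-- A series dominated in `L¹` by a summable sequence converges almost everywhere, and its sum is
integrable with the expected bound. -/
lemma L1norm_tsum_le {a : ℕ → ℝ → ℂ} {c : ℕ → ℝ} (ha : ∀ n, Integrable (a n))
    (hac : ∀ n, L1norm (a n) ≤ c n) (hc : Summable c) :
    (∀ᵐ x, Summable fun n => a n x) ∧ Integrable (fun x => ∑' n, a n x) ∧
      L1norm (fun x => ∑' n, a n x) ≤ ∑' n, c n := by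
  have hF : ∀ n, ‖(ha n).toL1 (a n)‖ ≤ c n := fun n =>
    (L1.norm_of_fun_eq_integral_norm (ha n)).trans_le (hac n)
  have hs : Summable fun n => ‖(ha n).toL1 (a n)‖ := hc.of_nonneg_of_le (fun _ => norm_nonneg _) hF
  have hcoe : ∀ᵐ x, ∀ n, (ha n).toL1 (a n) x = a n x := ae_all_iff.2 fun n => (ha n).coeFn_toL1
  have hsum : ∀ᵐ x, HasSum (fun n => a n x) ((∑' n, (ha n).toL1 (a n) : ℝ →₁[volume] ℂ) x) := by
    filter_upwards [Lp.hasSum_coeFn_tsum (tsum_enorm_ne_top_iff_summable_norm.2 hs), hcoe]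
      with x hx hx'
    simpa only [hx'] using hx
  have heq : (∑' n, (ha n).toL1 (a n) : ℝ →₁[volume] ℂ) =ᵐ[volume] fun x => ∑' n, a n x :=
    hsum.mono fun x hx => hx.tsum_eq.symm
  refine ⟨hsum.mono fun x hx => hx.summable, (L1.integrable_coeFn _).congr heq, ?_⟩
  rw [← L1norm_congr heq, L1norm, ← L1.norm_eq_integral_norm]
  exact (norm_tsum_le_tsum_norm hs).trans (hs.tsum_le_tsum hF hc)

lemma hasSum_exp_sub_one (y : ℝ) :
    HasSum (fun n : ℕ => y ^ (n + 1) / (n + 1).factorial) (Real.exp y - 1) := by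
  have h : HasSum (fun n : ℕ => y ^ n / n.factorial) (Real.exp y) := by
    rw [Real.exp_eq_exp_ℝ]
    exact NormedSpace.expSeries_div_hasSum_exp y
  simpa using (hasSum_nat_add_iff' 1).2 h

lemma hasSum_exp_sub_one_sub_self (y : ℝ) :
    HasSum (fun n : ℕ => y ^ (n + 2) / (n + 2).factorial) (Real.exp y - 1 - y) := by
  simpa using (hasSum_nat_add_iff' 1).2 (hasSum_exp_sub_one y)

lemma norm_exp2star_coeff (n : ℕ) :
    ‖((n + 2).factorial : ℂ) * ((2 * Real.pi : ℝ) : ℂ) ^ (n + 1)‖ =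
      (n + 2).factorial * (2 * Real.pi) ^ (n + 1) := by
  rw [norm_mul, norm_pow, Complex.norm_natCast, Complex.norm_real,
    Real.norm_of_nonneg Real.two_pi_pos.le]

lemma exp2star_bounds {f : ℝ → ℂ} {M : ℝ} (hf : Integrable f) (hM : L1norm f ≤ M) :
    (∀ᵐ ξ, Summable fun n : ℕ => convIter f (n + 1) ξ /
      (((n + 2).factorial : ℂ) * ((2 * Real.pi : ℝ) : ℂ) ^ (n + 1))) ∧
    Integrable (exp2star f) ∧
    L1norm (exp2star f) ≤
      2 * Real.pi * (Real.exp (M / (2 * Real.pi)) - 1 - M / (2 * Real.pi)) := by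
  have hs := (hasSum_exp_sub_one_sub_self (M / (2 * Real.pi))).mul_left (2 * Real.pi)
  rw [← hs.tsum_eq]
  refine L1norm_tsum_le (fun n => (integrable_convIter hf _).div_const _) (fun n => ?_) hs.summable
  rw [L1norm_div_const, norm_exp2star_coeff]
  have hpi := Real.pi_pos
  calc _ ≤ M ^ (n + 2) / ((n + 2).factorial * (2 * Real.pi) ^ (n + 1)) := by
        gcongr
        exact L1norm_convIter_le hf hM (n + 1)
    _ = _ := by
        rw [div_pow, pow_succ (2 * Real.pi) (n + 1)]
        field_simp

lemma L1norm_exp2star_sub_le {f g : ℝ → ℂ} {M : ℝ} (hf : Integrable f) (hg : Integrable g)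
    (hfM : L1norm f ≤ M) (hgM : L1norm g ≤ M) :
    L1norm (exp2star f - exp2star g) ≤
      (Real.exp (M / (2 * Real.pi)) - 1) * L1norm (f - g) := by
  have hs := (hasSum_exp_sub_one (M / (2 * Real.pi))).mul_right (L1norm (f - g))
  have hpi := Real.pi_pos
  have heq : exp2star f - exp2star g =ᵐ[volume] fun ξ => ∑' n : ℕ,
      (convIter f (n + 1) - convIter g (n + 1)) ξ /
        (((n + 2).factorial : ℂ) * ((2 * Real.pi : ℝ) : ℂ) ^ (n + 1)) := by
    filter_upwards [(exp2star_bounds hf hfM).1, (exp2star_bounds hg hgM).1] with ξ h1 h2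
    simp only [Pi.sub_apply, sub_div, exp2star]
    exact (h1.tsum_sub h2).symm
  rw [L1norm_congr heq, ← hs.tsum_eq]
  refine (L1norm_tsum_le (fun n => ((integrable_convIter hf _).sub
    (integrable_convIter hg _)).div_const _) (fun n => ?_) hs.summable).2.2
  rw [L1norm_div_const, norm_exp2star_coeff]
  calc _ ≤ ((n + 1 : ℕ) + 1) * M ^ (n + 1) * L1norm (f - g) /
          ((n + 2).factorial * (2 * Real.pi) ^ (n + 1)) := by
        gcongr
        exact L1norm_convIter_sub_le hf hg hfM hgM (n + 1)
    _ = _ := by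
        rw [div_pow, Nat.factorial_succ (n + 1)]
        push_cast
        field_simp

lemma exp2star_congr_ae {f g : ℝ → ℂ} (h : f =ᵐ[volume] g) : exp2star f = exp2star g := by
  have (n : ℕ) : convIter f (n + 1) = convIter g (n + 1) := conv_congr (convIter_congr_ae h n) h
  ext ξ
  simp only [exp2star, this]

/-- The Fourier multiplier of `Wb`. -/
def multWb (lam : ℝ) (b : ℝ → ℝ) (ξ : ℝ) : ℂ := (b ξ : ℂ) / ((4 * lam ^ 2 - ξ ^ 2 : ℝ) : ℂ)

lemma Wb_eq (lam : ℝ) (b : ℝ → ℝ) (f : ℝ → ℂ) : Wb lam b f = fun ξ => multWb lam b ξ * f ξ := by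
  ext ξ
  simp only [Wb, multWb]
  ring

lemma Wtb_eq (lam : ℝ) (b : ℝ → ℝ) (f : ℝ → ℂ) :
    Wtb lam b f = fun ξ => (-(Complex.I * ξ) * multWb lam b ξ) * f ξ := by
  ext ξ
  simp only [Wtb, multWb]
  ring

lemma Wb_sub (lam : ℝ) (b : ℝ → ℝ) (f g : ℝ → ℂ) :
    Wb lam b f - Wb lam b g = Wb lam b (f - g) := by
  ext ξ
  simp only [Wb_eq, Pi.sub_apply]
  ring

lemma Wtb_sub (lam : ℝ) (b : ℝ → ℝ) (f g : ℝ → ℂ) :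
    Wtb lam b f - Wtb lam b g = Wtb lam b (f - g) := by
  ext ξ
  simp only [Wtb_eq, Pi.sub_apply]
  ring

lemma Rop_congr_ae {lam : ℝ} {b : ℝ → ℝ} {w f g : ℝ → ℂ} (h : f =ᵐ[volume] g) :
    Rop lam b w f = Rop lam b w g := by
  have h1 : Wb lam b f =ᵐ[volume] Wb lam b g := h.mono fun ξ hξ => by simp only [Wb, hξ]
  have h2 : Wtb lam b f =ᵐ[volume] Wtb lam b g := h.mono fun ξ hξ => by simp only [Wtb, hξ]
  ext ξ
  simp only [Rop, exp2star_congr_ae h1, conv_congr h2 h2]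

section Estimates

variable {lam : ℝ} {b : ℝ → ℝ}

lemma BumpHyp.measurable_multWb (hb : BumpHyp lam b) : Measurable (multWb lam b) := by
  have hm : Measurable b := hb.1.continuous.measurable
  unfold multWb
  fun_prop

lemma BumpHyp.sq_lt (hb : BumpHyp lam b) {ξ : ℝ} (h : b ξ ≠ 0) : ξ ^ 2 < 2 * lam ^ 2 := by
  have hξ := hb.2.2.2.2 (subset_tsupport b h)
  calc ξ ^ 2 < (√2 * lam) ^ 2 := sq_lt_sq' hξ.1 hξ.2
    _ = 2 * lam ^ 2 := by rw [mul_pow, Real.sq_sqrt zero_le_two]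

lemma BumpHyp.norm_multWb_le (hlam : 0 < lam) (hb : BumpHyp lam b) (ξ : ℝ) :
    ‖multWb lam b ξ‖ ≤ 1 / (2 * lam ^ 2) := by
  rcases eq_or_ne (b ξ) 0 with h | h
  · simp only [multWb, h, Complex.ofReal_zero, zero_div, norm_zero]
    positivity
  · have hξ := hb.sq_lt h
    have h0 : 2 * lam ^ 2 ≤ 4 * lam ^ 2 - ξ ^ 2 := by linarith
    have hpos : 0 < 2 * lam ^ 2 := by positivity
    rw [multWb, norm_div, Complex.norm_real, Complex.norm_real,
      Real.norm_of_nonneg (hb.2.2.2.1 ξ).1, Real.norm_of_nonneg (hpos.le.trans h0)]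
    exact div_le_div₀ zero_le_one (hb.2.2.2.1 ξ).2 hpos h0

lemma BumpHyp.norm_mul_multWb_le (hlam : 0 < lam) (hb : BumpHyp lam b) (ξ : ℝ) :
    ‖-(Complex.I * ξ) * multWb lam b ξ‖ ≤ 1 / (√2 * lam) := by
  rcases eq_or_ne (b ξ) 0 with h | h
  · simp only [multWb, h, Complex.ofReal_zero, zero_div, mul_zero, norm_zero]
    positivity
  · have hξ : |ξ| ≤ √2 * lam := by
      have := hb.2.2.2.2 (subset_tsupport b h)
      exact abs_le.2 ⟨this.1.le, this.2.le⟩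
    rw [norm_mul, norm_neg, norm_mul, Complex.norm_I, one_mul, Complex.norm_real, Real.norm_eq_abs]
    calc |ξ| * ‖multWb lam b ξ‖ ≤ (√2 * lam) * (1 / (2 * lam ^ 2)) := by
          gcongr
          exact hb.norm_multWb_le hlam ξ
      _ = 1 / (√2 * lam) := by
          field_simp
          exact Real.sq_sqrt zero_le_two

lemma BumpHyp.integrable_Wb (hlam : 0 < lam) (hb : BumpHyp lam b) {f : ℝ → ℂ}
    (hf : Integrable f) : Integrable (Wb lam b f) := by
  rw [Wb_eq]
  exact hf.bdd_mul hb.measurable_multWb.aestronglyMeasurable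
    (Eventually.of_forall (hb.norm_multWb_le hlam))

lemma BumpHyp.integrable_Wtb (hlam : 0 < lam) (hb : BumpHyp lam b) {f : ℝ → ℂ}
    (hf : Integrable f) : Integrable (Wtb lam b f) := by
  rw [Wtb_eq]
  have := hb.measurable_multWb
  exact hf.bdd_mul (by fun_prop) (Eventually.of_forall (hb.norm_mul_multWb_le hlam))

lemma BumpHyp.L1norm_Wb_le (hlam : 0 < lam) (hb : BumpHyp lam b) {f : ℝ → ℂ}
    (hf : Integrable f) : L1norm (Wb lam b f) ≤ 1 / (2 * lam ^ 2) * L1norm f := by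
  rw [Wb_eq]
  exact L1norm_mul_le hf (hb.norm_multWb_le hlam)

lemma BumpHyp.L1norm_Wtb_le (hlam : 0 < lam) (hb : BumpHyp lam b) {f : ℝ → ℂ}
    (hf : Integrable f) : L1norm (Wtb lam b f) ≤ 1 / (√2 * lam) * L1norm f := by
  rw [Wtb_eq]
  exact L1norm_mul_le hf (hb.norm_mul_multWb_le hlam)

lemma BumpHyp.L1norm_Wb_le_of_le (hlam : 0 < lam) (hb : BumpHyp lam b) {f : ℝ → ℂ}
    (hf : Integrable f) (hfr : L1norm f ≤ Real.pi * lam ^ 2) :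
    L1norm (Wb lam b f) ≤ Real.pi / 2 := by
  calc L1norm (Wb lam b f) ≤ 1 / (2 * lam ^ 2) * L1norm f := hb.L1norm_Wb_le hlam hf
    _ ≤ 1 / (2 * lam ^ 2) * (Real.pi * lam ^ 2) := by gcongr
    _ = Real.pi / 2 := by field_simp

lemma BumpHyp.integrable_Rop (hlam : 0 < lam) (hb : BumpHyp lam b) {w f : ℝ → ℂ}
    (hw : Integrable w) (hf : Integrable f) : Integrable (Rop lam b w f) :=
  (((integrable_conv (hb.integrable_Wtb hlam hf) (hb.integrable_Wtb hlam hf)).const_mul _).sub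
    ((exp2star_bounds (hb.integrable_Wb hlam hf) le_rfl).2.1.const_mul _)).add hw

lemma exp_quarter_le : Real.exp (1 / 4) ≤ 13 / 10 := by
  have h : Real.exp (1 / 4) ^ 4 = Real.exp 1 := by rw [← Real.exp_nat_mul]; norm_num
  refine le_of_pow_le_pow_left₀ four_ne_zero (by norm_num) ?_
  rw [h]
  linarith [Real.exp_one_lt_d9, show (2.7182818286 : ℝ) ≤ (13 / 10) ^ 4 by norm_num]

lemma pi_div_two_div_two_pi : Real.pi / 2 / (2 * Real.pi) = 1 / 4 := by
  have := Real.pi_ne_zero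
  field_simp
  norm_num

/-- `Rop` maps the ball of radius `π λ²` to itself. -/
lemma BumpHyp.L1norm_Rop_le (hlam : 0 < lam) (hb : BumpHyp lam b) {w f : ℝ → ℂ}
    (hw : Integrable w) (hwr : L1norm w ≤ Real.pi / 2 * lam ^ 2)
    (hf : Integrable f) (hfr : L1norm f ≤ Real.pi * lam ^ 2) :
    L1norm (Rop lam b w f) ≤ Real.pi * lam ^ 2 := by
  have hpi := Real.pi_pos
  have hWt := hb.integrable_Wtb hlam hf
  have hconv := integrable_conv hWt hWt
  have hexp := exp2star_bounds (hb.integrable_Wb hlam hf) (hb.L1norm_Wb_le_of_le hlam hf hfr)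
  rw [pi_div_two_div_two_pi] at hexp
  have hWtle : L1norm (Wtb lam b f) ≤ 1 / (√2 * lam) * (Real.pi * lam ^ 2) :=
    (hb.L1norm_Wtb_le hlam hf).trans (by gcongr)
  have h1 : L1norm (conv (Wtb lam b f) (Wtb lam b f)) ≤ Real.pi ^ 2 * lam ^ 2 / 2 := by
    calc _ ≤ L1norm (Wtb lam b f) * L1norm (Wtb lam b f) := L1norm_conv_le hWt hWt
      _ ≤ (1 / (√2 * lam) * (Real.pi * lam ^ 2)) * (1 / (√2 * lam) * (Real.pi * lam ^ 2)) :=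
          mul_le_mul hWtle hWtle (L1norm_nonneg _) (by positivity)
      _ = Real.pi ^ 2 * lam ^ 2 / (√2 ^ 2) := by field_simp
      _ = _ := by rw [Real.sq_sqrt zero_le_two]
  have h2 : L1norm (exp2star (Wb lam b f)) ≤ 2 * Real.pi * (1 / 20) :=
    hexp.2.2.trans (by gcongr; linarith [exp_quarter_le])
  calc L1norm (Rop lam b w f)
      ≤ L1norm (fun ξ => ((1 / (8 * Real.pi) : ℝ) : ℂ) * conv (Wtb lam b f) (Wtb lam b f) ξ)
        + L1norm (fun ξ => ((4 * lam ^ 2 : ℝ) : ℂ) * exp2star (Wb lam b f) ξ) + L1norm w :=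
        (L1norm_add_le ((hconv.const_mul _).sub (hexp.2.1.const_mul _)) hw).trans
          (add_le_add_left (L1norm_sub_le (hconv.const_mul _) (hexp.2.1.const_mul _)) _)
    _ ≤ 1 / (8 * Real.pi) * (Real.pi ^ 2 * lam ^ 2 / 2) + 4 * lam ^ 2 * (2 * Real.pi * (1 / 20))
        + Real.pi / 2 * lam ^ 2 := by
        rw [L1norm_const_mul, L1norm_const_mul, Complex.norm_real, Complex.norm_real,
          Real.norm_of_nonneg (by positivity), Real.norm_of_nonneg (by positivity)]
        gcongr
    _ = 77 / 80 * (Real.pi * lam ^ 2) := by field_simp; ring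
    _ ≤ Real.pi * lam ^ 2 := by nlinarith [show 0 < Real.pi * lam ^ 2 by positivity]

/-- `Rop` is a contraction on the ball of radius `π λ²`. -/
lemma BumpHyp.L1norm_Rop_sub_le (hlam : 0 < lam) (hb : BumpHyp lam b) {w f g : ℝ → ℂ}
    (hf : Integrable f) (hfr : L1norm f ≤ Real.pi * lam ^ 2)
    (hg : Integrable g) (hgr : L1norm g ≤ Real.pi * lam ^ 2) :
    L1norm (Rop lam b w f - Rop lam b w g) ≤ 3 / 4 * L1norm (f - g) := by
  have hpi := Real.pi_pos
  have hd := L1norm_nonneg (f - g)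
  have hWtf := hb.integrable_Wtb hlam hf
  have hWtg := hb.integrable_Wtb hlam hg
  have hWf := hb.integrable_Wb hlam hf
  have hWg := hb.integrable_Wb hlam hg
  have hconv := (integrable_conv hWtf hWtf).sub (integrable_conv hWtg hWtg)
  have hexp := (exp2star_bounds hWf le_rfl).2.1.sub (exp2star_bounds hWg le_rfl).2.1
  have hWtle {h : ℝ → ℂ} (hh : Integrable h) (hhr : L1norm h ≤ Real.pi * lam ^ 2) :
      L1norm (Wtb lam b h) ≤ 1 / (√2 * lam) * (Real.pi * lam ^ 2) :=
    (hb.L1norm_Wtb_le hlam hh).trans (by gcongr)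
  have h1 : L1norm (conv (Wtb lam b f) (Wtb lam b f) - conv (Wtb lam b g) (Wtb lam b g)) ≤
      Real.pi * L1norm (f - g) := by
    have hsub := hb.L1norm_Wtb_le hlam (hf.sub hg)
    rw [← Wtb_sub] at hsub
    calc _ ≤ _ := L1norm_conv_sub_conv_le hWtf hWtg hWtf hWtg
      _ ≤ (1 / (√2 * lam) * L1norm (f - g)) * (1 / (√2 * lam) * (Real.pi * lam ^ 2)) +
          (1 / (√2 * lam) * (Real.pi * lam ^ 2)) * (1 / (√2 * lam) * L1norm (f - g)) :=
          add_le_add (mul_le_mul hsub (hWtle hf hfr) (L1norm_nonneg _) (by positivity))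
            (mul_le_mul (hWtle hg hgr) hsub (L1norm_nonneg _) (by positivity))
      _ = 2 * Real.pi * L1norm (f - g) / √2 ^ 2 := by field_simp; ring
      _ = _ := by rw [Real.sq_sqrt zero_le_two]; ring
  have h2 : L1norm (exp2star (Wb lam b f) - exp2star (Wb lam b g)) ≤
      3 / 10 * (1 / (2 * lam ^ 2) * L1norm (f - g)) := by
    have hsub := L1norm_exp2star_sub_le hWf hWg (hb.L1norm_Wb_le_of_le hlam hf hfr)
      (hb.L1norm_Wb_le_of_le hlam hg hgr)
    rw [pi_div_two_div_two_pi, Wb_sub] at hsub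
    exact hsub.trans (mul_le_mul (by linarith [exp_quarter_le]) (hb.L1norm_Wb_le hlam (hf.sub hg))
      (L1norm_nonneg _) (by norm_num))
  have heq : Rop lam b w f - Rop lam b w g =
      (fun ξ => ((1 / (8 * Real.pi) : ℝ) : ℂ) *
        (conv (Wtb lam b f) (Wtb lam b f) - conv (Wtb lam b g) (Wtb lam b g)) ξ) -
      fun ξ => ((4 * lam ^ 2 : ℝ) : ℂ) *
        (exp2star (Wb lam b f) - exp2star (Wb lam b g)) ξ := by
    ext ξ
    simp only [Rop, Pi.sub_apply]
    ring
  rw [heq]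
  calc _ ≤ _ := L1norm_sub_le (hconv.const_mul _) (hexp.const_mul _)
    _ ≤ 1 / (8 * Real.pi) * (Real.pi * L1norm (f - g))
        + 4 * lam ^ 2 * (3 / 10 * (1 / (2 * lam ^ 2) * L1norm (f - g))) := by
        rw [L1norm_const_mul, L1norm_const_mul, Complex.norm_real, Complex.norm_real,
          Real.norm_of_nonneg (by positivity), Real.norm_of_nonneg (by positivity)]
        gcongr
    _ = 29 / 40 * L1norm (f - g) := by field_simp; ring
    _ ≤ 3 / 4 * L1norm (f - g) := by linarith

end Estimates

/-- Theorem `convergence:theorem1`: the fixed point iterates for the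
band-limited equation converge in `L¹` to a solution. -/
theorem stmt_3
    (lam : ℝ) (hlam : 0 < lam)
    (b : ℝ → ℝ) (hb : BumpHyp lam b)
    (w : ℝ → ℂ) (hw_int : Integrable w)
    (hw_norm : L1norm w ≤ (Real.pi / 2) * lam ^ 2)
    (ψseq : ℕ → ℝ → ℂ)
    (hψ0 : ψseq 0 = w)
    (hψsucc : ∀ n : ℕ, ψseq (n + 1) = Rop lam b w (ψseq n)) :
    ∃ ψ : ℝ → ℂ, Integrable ψ ∧
      Tendsto (fun n : ℕ => L1norm (fun ξ : ℝ => ψseq n ξ - ψ ξ)) atTop (nhds 0) ∧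
      ∀ᵐ ξ : ℝ, ψ ξ = Rop lam b w ψ ξ := by
  let T : (ℝ →₁[volume] ℂ) → (ℝ →₁[volume] ℂ) := fun f =>
    (hb.integrable_Rop hlam hw_int (L1.integrable_coeFn f)).toL1 _
  have hTcoe (f : ℝ →₁[volume] ℂ) : T f =ᵐ[volume] Rop lam b w f := Integrable.coeFn_toL1 _
  have hnorm (f : ℝ →₁[volume] ℂ) : ‖f‖ = L1norm f := L1.norm_eq_integral_norm f
  have hdist (f g : ℝ →₁[volume] ℂ) : dist f g = L1norm (⇑f - ⇑g) := by
    rw [L1.dist_eq_integral_dist]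
    simp only [dist_eq_norm, L1norm, Pi.sub_apply]
  set s : Set (ℝ →₁[volume] ℂ) := Metric.closedBall 0 (Real.pi * lam ^ 2) with hs
  have hmem (f : ℝ →₁[volume] ℂ) : f ∈ s ↔ L1norm f ≤ Real.pi * lam ^ 2 := by
    rw [hs, mem_closedBall_zero_iff, hnorm]
  have hmaps : Set.MapsTo T s s := fun f hf => by
    rw [hmem] at hf ⊢
    rw [L1norm_congr (hTcoe f)]
    exact hb.L1norm_Rop_le hlam hw_int hw_norm (L1.integrable_coeFn f) hf
  have hcontr : ContractingWith (3 / 4) (hmaps.restrict T s s) := by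
    refine ⟨by rw [← NNReal.coe_lt_coe]; norm_num, LipschitzWith.of_dist_le_mul ?_⟩
    rintro ⟨f, hf⟩ ⟨g, hg⟩
    rw [hmem] at hf hg
    simp only [Subtype.dist_eq, Set.MapsTo.val_restrict_apply, hdist]
    rw [L1norm_congr ((hTcoe f).sub (hTcoe g))]
    simpa using hb.L1norm_Rop_sub_le hlam (w := w) (L1.integrable_coeFn f) hf
      (L1.integrable_coeFn g) hg
  have hw_mem : hw_int.toL1 w ∈ s := by
    rw [hmem, L1norm_congr hw_int.coeFn_toL1]
    nlinarith [show 0 < Real.pi * lam ^ 2 by positivity]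
  obtain ⟨ψ, -, hfix, hlim, -⟩ := ContractingWith.exists_fixedPoint'
    Metric.isClosed_closedBall.isComplete hmaps hcontr hw_mem (edist_ne_top _ _)
  have hiter (n : ℕ) : T^[n] (hw_int.toL1 w) =ᵐ[volume] ψseq n := by
    induction n with
    | zero => rw [hψ0]; exact hw_int.coeFn_toL1
    | succ n ih =>
      rw [Function.iterate_succ_apply', hψsucc, ← Rop_congr_ae ih]
      exact hTcoe _
  refine ⟨ψ, L1.integrable_coeFn ψ, ?_, ?_⟩
  · refine (tendsto_iff_dist_tendsto_zero.1 hlim).congr fun n => ?_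
    rw [hdist]
    exact L1norm_congr ((hiter n).sub .rfl)
  · have := hTcoe ψ
    rwa [hfix.eq] at this

end
end

section
/- Suppose μ and C are real numbers with 0 ≤ C < μ, and f ∈ L¹(ℝ) satisfies |f(ξ)| ≤ C·exp(−μ|ξ|) for all ξ ∈ ℝ. Then |exp₂*[f](ξ)| ≤ (C²/(2π))·exp(−μ|ξ|)·((1 + μ|ξ|)/μ)·exp(C/(2πμ))·exp((C/(2π))·|ξ|) for all ξ ∈ ℝ. -/
open MeasureTheory Filter

noncomputable section

theorem integrable_indicator_Iic_exp {p : ℝ} (hp : 0 < p) (z : ℝ) :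
    Integrable ((Set.Iic z).indicator fun y => Real.exp (p * (y - z))) := by
  rw [integrable_indicator_iff measurableSet_Iic]
  simp_rw [mul_sub, Real.exp_sub]
  exact (integrableOn_exp_mul_Iic hp z).div_const _

theorem integral_indicator_Iic_exp {p : ℝ} (hp : 0 < p) (z : ℝ) :
    ∫ y, (Set.Iic z).indicator (fun y => Real.exp (p * (y - z))) y = 1 / p := by
  rw [integral_indicator measurableSet_Iic]
  simp_rw [mul_sub, Real.exp_sub]
  rw [integral_div, integral_exp_mul_Iic hp]
  have := (Real.exp_pos (p * z)).ne'
  field_simp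

theorem integrable_indicator_Ioi_exp {q : ℝ} (hq : 0 < q) (z : ℝ) :
    Integrable ((Set.Ioi z).indicator fun y => Real.exp (-q * (y - z))) := by
  rw [integrable_indicator_iff measurableSet_Ioi]
  simp_rw [mul_sub, Real.exp_sub]
  exact (integrableOn_exp_mul_Ioi (neg_lt_zero.2 hq) z).div_const _

theorem integral_indicator_Ioi_exp {q : ℝ} (hq : 0 < q) (z : ℝ) :
    ∫ y, (Set.Ioi z).indicator (fun y => Real.exp (-q * (y - z))) y = 1 / q := by
  rw [integral_indicator measurableSet_Ioi]
  simp_rw [mul_sub, Real.exp_sub]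
  rw [integral_div, integral_exp_mul_Ioi (neg_lt_zero.2 hq)]
  have := (Real.exp_pos (-q * z)).ne'
  field_simp

/-- A bound on `‖∫ F‖` in terms of a kernel `k x y` invariant under `(x, y) ↦ (-x, -y)` needs
to be checked for `0 ≤ x` only. -/
theorem norm_integral_le_of_even_kernel {k : ℝ → ℝ → ℝ} {b : ℝ → ℝ}
    (hk : ∀ x y, k (-x) (-y) = k x y)
    (h : ∀ x, 0 ≤ x → ∀ F : ℝ → ℂ, (∀ y, ‖F y‖ ≤ k x y) → ‖∫ y, F y‖ ≤ b x)
    (x : ℝ) (F : ℝ → ℂ) (hF : ∀ y, ‖F y‖ ≤ k x y) : ‖∫ y, F y‖ ≤ b |x| := by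
  rcases le_total 0 x with hx | hx
  · rw [abs_of_nonneg hx]
    exact h x hx F hF
  · rw [abs_of_nonpos hx, ← integral_neg_eq_self F]
    refine h (-x) (neg_nonneg.2 hx) (fun y => F (-y)) fun y => ?_
    rw [← hk, neg_neg]
    exact hF (-y)

theorem norm_integral_le_of_exp_kernel {μ A : ℝ} (hμ : 0 < μ) (hA : 0 ≤ A) (x : ℝ) (F : ℝ → ℂ)
    (hF : ∀ y, ‖F y‖ ≤ A * Real.exp (-μ * |x - y|) * Real.exp (-μ * |y|)) :
    ‖∫ y, F y‖ ≤ A * Real.exp (-μ * |x|) * ((1 + μ * |x|) / μ) := by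
  refine norm_integral_le_of_even_kernel
    (k := fun x y => A * Real.exp (-μ * |x - y|) * Real.exp (-μ * |y|))
    (b := fun x => A * Real.exp (-μ * x) * ((1 + μ * x) / μ)) ?_ ?_ x F hF
  · intro x y
    have : -x - -y = -(x - y) := by ring
    simp only [this, abs_neg]
  · intro x hx F hF
    have h1 := integrable_indicator_Iic_exp (p := 2 * μ) (by positivity) 0
    have h2 := integrable_indicator_Ioi_exp (q := 2 * μ) (by positivity) x
    have h3 : Integrable ((Set.Ioc 0 x).indicator fun _ => (1 : ℝ)) := by
      rw [integrable_indicator_iff measurableSet_Ioc]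
      exact integrableOn_const (by simp)
    have hb := norm_integral_le_of_norm_le (f := F)
      (((h1.add h2).add h3).const_mul (A * Real.exp (-μ * x)))
      (ae_of_all _ fun y => (hF y).trans ?_)
    · refine hb.trans_eq ?_
      rw [integral_const_mul]
      congr 1
      simp only [Pi.add_apply]
      rw [integral_add (by exact h1.add h2) h3, integral_add h1 h2,
        integral_indicator_Iic_exp (by positivity), integral_indicator_Ioi_exp (by positivity),
        integral_indicator measurableSet_Ioc]
      simp [hx]
      field_simp
      ring
    · simp only [Pi.add_apply]
      rw [mul_assoc, mul_assoc]
      refine mul_le_mul_of_nonneg_left ?_ hA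
      rw [← Real.exp_add]
      rcases le_or_gt y 0 with hy | hy
      · rw [Set.indicator_of_mem (Set.mem_Iic.2 hy),
          Set.indicator_of_notMem (by simp; linarith), Set.indicator_of_notMem (by simp; intro; linarith),
          abs_of_nonpos hy, abs_of_nonneg (by linarith), add_zero, add_zero, ← Real.exp_add]
        refine Real.exp_le_exp.2 (le_of_eq ?_)
        ring
      rcases le_or_gt y x with hyx | hyx
      · rw [Set.indicator_of_notMem (by simp; linarith),
          Set.indicator_of_notMem (by simp; linarith), Set.indicator_of_mem (Set.mem_Ioc.2 ⟨hy, hyx⟩),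
          abs_of_pos hy, abs_of_nonneg (by linarith), add_zero, zero_add, mul_one]
        refine Real.exp_le_exp.2 (le_of_eq ?_)
        ring
      · rw [Set.indicator_of_notMem (by simp; linarith),
          Set.indicator_of_mem (Set.mem_Ioi.2 hyx), Set.indicator_of_notMem (by simp; intro; linarith),
          abs_of_pos hy, abs_of_neg (by linarith), add_zero, zero_add, ← Real.exp_add]
        refine Real.exp_le_exp.2 (le_of_eq ?_)
        ring

theorem weighted_exp_kernel_le {μ a x : ℝ} (ha : 0 < a) (haμ : 2 * a ≤ μ) (hx : 0 ≤ x) (y : ℝ) :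
    Real.exp (-μ * |x - y|) * ((1 + μ * |y|) * Real.exp (-(μ - a) * |y|)) ≤
      (1 + μ * x) * Real.exp (-(μ - a) * x) *
        ((Set.Iic x).indicator (fun y => Real.exp (a * (y - x))) y +
          (Set.Ioi x).indicator (fun y => Real.exp (-(μ - a) * (y - x))) y) := by
  have hμ : 0 < μ := by linarith
  have key : ∀ w, x ≤ w → 1 + μ * w ≤ (1 + μ * x) * Real.exp (μ * (w - x)) := fun w hw => by
    have h1 := Real.add_one_le_exp (μ * (w - x))
    have h2 : 0 ≤ μ * x * (μ * (w - x)) :=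
      mul_nonneg (by positivity) (mul_nonneg hμ.le (by linarith))
    calc 1 + μ * w ≤ (1 + μ * x) * (μ * (w - x) + 1) := by linarith
      _ ≤ _ := by gcongr
  rcases le_or_gt y x with hyx | hyx
  · rw [Set.indicator_of_mem (Set.mem_Iic.2 hyx), Set.indicator_of_notMem (by simpa using hyx),
      add_zero, abs_of_nonneg (by linarith), mul_left_comm, ← Real.exp_add, mul_assoc,
      ← Real.exp_add]
    rcases le_or_gt |y| x with hy | hy
    · refine mul_le_mul (by gcongr) (Real.exp_le_exp.2 ?_) (Real.exp_pos _).le (by positivity)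
      nlinarith [le_abs_self y]
    · have hy0 : y < 0 := by
        by_contra! h
        rw [abs_of_nonneg h] at hy
        linarith
      rw [abs_of_neg hy0] at hy ⊢
      refine (mul_le_mul_of_nonneg_right (key _ hy.le) (Real.exp_pos _).le).trans ?_
      rw [mul_assoc, ← Real.exp_add]
      refine mul_le_mul_of_nonneg_left (Real.exp_le_exp.2 ?_) (by positivity)
      nlinarith
  · have hy : 0 < y := by linarith
    rw [Set.indicator_of_notMem (by simpa using hyx), Set.indicator_of_mem (Set.mem_Ioi.2 hyx),
      zero_add, abs_of_neg (by linarith), abs_of_pos hy, mul_left_comm, ← Real.exp_add,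
      mul_assoc, ← Real.exp_add]
    refine (mul_le_mul_of_nonneg_right (key _ hyx.le) (Real.exp_pos _).le).trans (le_of_eq ?_)
    rw [mul_assoc, ← Real.exp_add]
    congr 2
    ring

theorem norm_integral_le_of_weighted_exp_kernel {μ a A : ℝ} (ha : 0 < a) (haμ : 2 * a ≤ μ)
    (hA : 0 ≤ A) (x : ℝ) (F : ℝ → ℂ)
    (hF : ∀ y, ‖F y‖ ≤
      A * (Real.exp (-μ * |x - y|) * ((1 + μ * |y|) * Real.exp (-(μ - a) * |y|)))) :
    ‖∫ y, F y‖ ≤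
      A * ((1 + μ * |x|) * Real.exp (-(μ - a) * |x|)) * (1 / a + 1 / (μ - a)) := by
  refine norm_integral_le_of_even_kernel
    (k := fun x y =>
      A * (Real.exp (-μ * |x - y|) * ((1 + μ * |y|) * Real.exp (-(μ - a) * |y|))))
    (b := fun x => A * ((1 + μ * x) * Real.exp (-(μ - a) * x)) * (1 / a + 1 / (μ - a)))
    ?_ ?_ x F hF
  · intro x y
    have : -x - -y = -(x - y) := by ring
    simp only [this, abs_neg]
  · intro x hx F hF
    have hs : 0 < μ - a := by linarith
    have h1 := integrable_indicator_Iic_exp ha x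
    have h2 := integrable_indicator_Ioi_exp hs x
    have hb := norm_integral_le_of_norm_le (f := F)
      ((h1.add h2).const_mul (A * ((1 + μ * x) * Real.exp (-(μ - a) * x))))
      (ae_of_all _ fun y => (hF y).trans ?_)
    · refine hb.trans_eq ?_
      rw [integral_const_mul]
      congr 1
      simp only [Pi.add_apply]
      rw [integral_add h1 h2, integral_indicator_Iic_exp ha, integral_indicator_Ioi_exp hs]
    · rw [mul_assoc]
      exact mul_le_mul_of_nonneg_left (weighted_exp_kernel_le ha haμ hx y) hA

theorem conv_eq_integral_swap (g f : ℝ → ℂ) (ξ : ℝ) :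
    conv g f ξ = ∫ y, g y * f (ξ - y) := by
  rw [← integral_sub_left_eq_self (fun y => g y * f (ξ - y)) volume ξ]
  simp only [sub_sub_cancel, conv]

theorem norm_convIter_succ_le {μ C : ℝ} (hC : 0 < C) (hCμ : C < μ) {f : ℝ → ℂ}
    (hbd : ∀ ξ : ℝ, ‖f ξ‖ ≤ C * Real.exp (-μ * |ξ|)) (n : ℕ) (x : ℝ) :
    ‖convIter f (n + 1) x‖ ≤ C ^ 2 / μ * (6 / 5 * (2 * Real.pi)) ^ n *
      ((1 + μ * |x|) * Real.exp (-(μ - C / (2 * Real.pi)) * |x|)) := by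
  have hμ : 0 < μ := hC.trans hCμ
  have hpi := Real.pi_gt_three
  set a := C / (2 * Real.pi) with ha_def
  have hCa : C = a * (2 * Real.pi) := by rw [ha_def]; field_simp
  have ha : 0 < a := by positivity
  have haμ : 6 * a ≤ μ := by nlinarith
  induction n generalizing x with
  | zero =>
    have h := norm_integral_le_of_exp_kernel hμ (sq_nonneg C) x (fun y => f (x - y) * f y)
      fun y => by
        rw [norm_mul]
        refine (mul_le_mul (hbd _) (hbd _) (norm_nonneg _) (by positivity)).trans_eq ?_
        ring
    refine h.trans ?_
    have he : Real.exp (-μ * |x|) ≤ Real.exp (-(μ - a) * |x|) :=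
      Real.exp_le_exp.2 (by nlinarith [abs_nonneg x])
    calc _ = C ^ 2 / μ * (1 + μ * |x|) * Real.exp (-μ * |x|) := by ring
      _ ≤ C ^ 2 / μ * (1 + μ * |x|) * Real.exp (-(μ - a) * |x|) := by gcongr
      _ = _ := by ring
  | succ n ih =>
    have hB : 0 ≤ C ^ 2 / μ * (6 / 5 * (2 * Real.pi)) ^ n := by positivity
    have h := norm_integral_le_of_weighted_exp_kernel (μ := μ) ha (by linarith) (mul_nonneg hB hC.le) x
      (fun y => convIter f (n + 1) y * f (x - y)) fun y => by
        rw [norm_mul]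
        refine (mul_le_mul (ih y) (hbd _) (norm_nonneg _) (by positivity)).trans_eq ?_
        ring
    rw [← conv_eq_integral_swap] at h
    refine h.trans ?_
    have hs : 0 < μ - a := by linarith
    have hK : C * (1 / a + 1 / (μ - a)) ≤ 6 / 5 * (2 * Real.pi) := by
      have : C * (1 / a + 1 / (μ - a)) = (μ / (μ - a)) * (2 * Real.pi) := by
        rw [hCa]
        field_simp
        ring
      rw [this]
      refine mul_le_mul_of_nonneg_right ?_ (by positivity)
      rw [div_le_div_iff₀ hs (by norm_num)]
      linarith
    have hW : 0 ≤ C ^ 2 / μ * (6 / 5 * (2 * Real.pi)) ^ n *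
      ((1 + μ * |x|) * Real.exp (-(μ - a) * |x|)) := by positivity
    refine le_of_eq_of_le ?_ ((mul_le_mul_of_nonneg_left hK hW).trans_eq ?_) <;> ring

theorem two_mul_three_pow_le_factorial (n : ℕ) : (2 : ℝ) * 3 ^ n ≤ (n + 2).factorial := by
  have h : (2).factorial * (2 + 1) ^ n ≤ (2 + n).factorial := Nat.factorial_mul_pow_le_factorial
  rw [add_comm n 2]
  exact_mod_cast h

/-- Lemma `spectrum:S2`: pointwise bound for `exp₂*[f]` when `f` decays
exponentially. -/
theorem stmt_4
    (μ C : ℝ) (hC : 0 ≤ C) (hCμ : C < μ)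
    (f : ℝ → ℂ) (hf : Integrable f)
    (hbd : ∀ ξ : ℝ, ‖f ξ‖ ≤ C * Real.exp (-μ * |ξ|)) :
    ∀ ξ : ℝ, ‖exp2star f ξ‖ ≤
      (C ^ 2 / (2 * Real.pi)) * Real.exp (-μ * |ξ|) * ((1 + μ * |ξ|) / μ)
        * Real.exp (C / (2 * Real.pi * μ)) * Real.exp ((C / (2 * Real.pi)) * |ξ|) := by
  intro ξ
  rcases hC.eq_or_lt with rfl | hC
  · have hf0 : f = 0 := funext fun ξ => by simpa using hbd ξ
    subst hf0
    simp [exp2star, convIter, conv]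
  have hμ : 0 < μ := hC.trans hCμ
  have hpi := Real.pi_pos
  set B := C ^ 2 / (2 * Real.pi) / μ *
    ((1 + μ * |ξ|) * Real.exp (-(μ - C / (2 * Real.pi)) * |ξ|)) with hB_def
  have hB : 0 ≤ B := by positivity
  have hgeom := (hasSum_geometric_of_lt_one (r := (2 / 5 : ℝ)) (by norm_num)
    (by norm_num)).mul_left (B / 2)
  have hsum : ‖exp2star f ξ‖ ≤ B / 2 * (1 - 2 / 5)⁻¹ := by
    refine tsum_of_norm_bounded hgeom fun n => ?_
    have hfac := two_mul_three_pow_le_factorial n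
    have hden : ‖((Nat.factorial (n + 2) : ℂ) * ((2 * Real.pi : ℝ) : ℂ) ^ (n + 1))‖ =
        (n + 2).factorial * (2 * Real.pi) ^ (n + 1) := by
      rw [norm_mul, norm_pow, Complex.norm_natCast, Complex.norm_real,
        Real.norm_of_nonneg (by positivity)]
    rw [norm_div, hden]
    calc _ ≤ _ / (2 * 3 ^ n * (2 * Real.pi) ^ (n + 1)) :=
          div_le_div₀ (by positivity) (norm_convIter_succ_le hC hCμ hbd n ξ) (by positivity)
            (by gcongr)
      _ = B / 2 * (2 / 5) ^ n := by
          rw [hB_def, show (2 / 5 : ℝ) = 6 / 5 / 3 by norm_num, mul_pow, div_pow (6 / 5 : ℝ) 3,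
            pow_succ]
          field_simp
          ring
  calc ‖exp2star f ξ‖ ≤ B * 1 := by linarith
    _ ≤ B * Real.exp (C / (2 * Real.pi * μ)) := by
        gcongr
        exact Real.one_le_exp (by positivity)
    _ = _ := by
        have he : Real.exp (-(μ - C / (2 * Real.pi)) * |ξ|) =
            Real.exp (-μ * |ξ|) * Real.exp (C / (2 * Real.pi) * |ξ|) := by
          rw [← Real.exp_add]
          congr 1
          ring
        rw [hB_def, he]
        ring

end
end

section
/- Suppose μ > 0 and C ≥ 0 are real numbers, and f ∈ L¹(ℝ) satisfies |f(ξ)| ≤ C·exp(−μ|ξ|) for all ξ ∈ ℝ. Then |exp₂*[f](ξ)| ≤ C·exp(−μ|ξ|)·(M((1 + μ|ξ|)/2, 2, C/(πμ)) − 1) for all ξ ∈ ℝ, where M(a,b,z) denotes Kummer's confluent hypergeometric function. -/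
open MeasureTheory Filter

noncomputable section

/-- The functions `θₙ(|x|) e^{-|x|}` with `θₙ` the reverse Bessel polynomials, which are
`n!` times the `(n+1)`-fold convolution power of `e^{-|x|}`. -/
def besselFun : ℕ → ℝ → ℝ
  | 0, x => Real.exp (-|x|)
  | 1, x => (1 + |x|) * Real.exp (-|x|)
  | n + 2, x => (2 * n + 3) * besselFun (n + 1) x + x ^ 2 * besselFun n x

lemma besselFun_neg (n : ℕ) (x : ℝ) : besselFun n (-x) = besselFun n x := by
  induction n using Nat.twoStepInduction with
  | zero => simp [besselFun]
  | one => simp [besselFun]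
  | more n h0 h1 => simp [besselFun, h0, h1]

lemma besselFun_bounds (n : ℕ) (x : ℝ) :
    0 ≤ besselFun n x ∧ |x| * besselFun n x ≤ besselFun (n + 1) x ∧
      besselFun (n + 1) x ≤ (2 * n + 1 + |x|) * besselFun n x := by
  have hx := abs_nonneg x
  induction n with
  | zero =>
    refine ⟨by simp only [besselFun]; positivity, ?_, by simp [besselFun]⟩
    simp only [besselFun]
    gcongr
    linarith
  | succ n ih =>
    obtain ⟨h0, h1, h2⟩ := ih
    have h3 : 0 ≤ besselFun (n + 1) x := (mul_nonneg hx h0).trans h1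
    have h4 : x ^ 2 = |x| * |x| := by rw [← sq, sq_abs]
    refine ⟨h3, ?_, ?_⟩ <;> simp only [besselFun, h4] <;> push_cast
    · have h5 : |x| * besselFun (n + 1) x ≤ |x| * ((2 * n + 1 + |x|) * besselFun n x) :=
        mul_le_mul_of_nonneg_left h2 hx
      have h6 : (2 * n + 1 : ℝ) * (|x| * besselFun n x) ≤ (2 * n + 1) * besselFun (n + 1) x :=
        mul_le_mul_of_nonneg_left h1 (by positivity)
      nlinarith
    · have h5 : |x| * (|x| * besselFun n x) ≤ |x| * besselFun (n + 1) x :=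
        mul_le_mul_of_nonneg_left h1 hx
      nlinarith

lemma hasDerivAt_besselFun (n : ℕ) (x : ℝ) :
    HasDerivAt (besselFun (n + 1)) (-x * besselFun n x) x ∧
      HasDerivAt (fun y => y * besselFun n y)
        (2 * (n + 1) * besselFun n x - besselFun (n + 1) x) x := by
  induction n generalizing x with
  | zero =>
    have habs (y : ℝ) (hy : y ≠ 0) : HasDerivAt (|·|) (SignType.sign y : ℝ) y := hasDerivAt_abs hy
    have hexp (y : ℝ) (hy : y ≠ 0) :
        HasDerivAt (fun y : ℝ => Real.exp (-|y|))
          (Real.exp (-|y|) * -(SignType.sign y : ℝ)) y := (habs y hy).neg.exp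
    have hs (y : ℝ) : (SignType.sign y : ℝ) * |y| = y := sign_mul_abs y
    constructor
    · refine hasDerivAt_of_hasDerivAt_of_ne' (x := 0) (g := fun x => -x * besselFun 0 x)
        (fun y hy => ?_) ?_ ?_ x
      · refine (((habs y hy).const_add 1).mul (hexp y hy)).congr_deriv ?_
        simp only [besselFun]
        linear_combination (-Real.exp (-|y|)) * hs y
      · change ContinuousAt (fun x : ℝ => (1 + |x|) * Real.exp (-|x|)) 0
        fun_prop
      · simp only [besselFun]
        fun_prop
    · refine hasDerivAt_of_hasDerivAt_of_ne' (x := 0)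
        (g := fun x => 2 * (((0 : ℕ) : ℝ) + 1) * besselFun 0 x - besselFun (0 + 1) x)
        (fun y hy => ?_) ?_ ?_ x
      · refine ((hasDerivAt_id y).mul (hexp y hy)).congr_deriv ?_
        have h : y * (SignType.sign y : ℝ) = |y| := by rw [mul_comm]; exact sign_mul_self y
        simp only [besselFun, id]
        push_cast
        linear_combination (-Real.exp (-|y|)) * h
      · simp only [besselFun]
        fun_prop
      · simp only [besselFun]
        fun_prop
  | succ n ih =>
    obtain ⟨hA, hB⟩ := ih x
    constructor
    · have h : besselFun (n + 1 + 1) =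
          fun y => (2 * n + 3) * besselFun (n + 1) y + y * (y * besselFun n y) := by
        ext y
        simp only [besselFun]
        ring
      rw [h]
      refine ((hA.const_mul (2 * (n : ℝ) + 3)).add ((hasDerivAt_id x).mul hB)).congr_deriv ?_
      simp only [id]
      ring
    · refine ((hasDerivAt_id x).mul hA).congr_deriv ?_
      simp only [id, besselFun]
      push_cast
      ring

lemma tendsto_exp_mul_besselFun (n : ℕ) (x : ℝ) :
    Tendsto (fun y => -(Real.exp (x - y) * (besselFun (n + 1) y - y * besselFun n y))
      / (2 * (n + 1))) atTop (nhds 0) := by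
  have hanti : AntitoneOn (besselFun (n + 1)) (Set.Ici 0) := by
    refine antitoneOn_of_deriv_nonpos (convex_Ici 0)
      (fun y _ => (hasDerivAt_besselFun n y).1.continuousAt.continuousWithinAt)
      (fun y _ => (hasDerivAt_besselFun n y).1.differentiableAt.differentiableWithinAt) ?_
    intro y hy
    rw [interior_Ici, Set.mem_Ioi] at hy
    rw [(hasDerivAt_besselFun n y).1.deriv]
    nlinarith [(besselFun_bounds n y).1]
  have hexp : Tendsto (fun y => Real.exp (x - y)) atTop (nhds 0) :=
    Real.tendsto_exp_atBot.comp (tendsto_atBot_add_const_left _ x tendsto_neg_atTop_atBot)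
  have hbdd : Tendsto (fun y => Real.exp (x - y) * (besselFun (n + 1) y - y * besselFun n y))
      atTop (nhds 0) := by
    refine squeeze_zero' (g := fun y => Real.exp (x - y) * besselFun (n + 1) 0) ?_ ?_
      (by simpa using hexp.mul_const (besselFun (n + 1) 0))
    · filter_upwards [eventually_ge_atTop 0] with y hy
      have := (besselFun_bounds n y).2.1
      rw [abs_of_nonneg hy] at this
      exact mul_nonneg (Real.exp_pos _).le (sub_nonneg.2 this)
    · filter_upwards [eventually_ge_atTop 0] with y hy
      refine mul_le_mul_of_nonneg_left ?_ (Real.exp_pos _).le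
      have h1 := hanti Set.self_mem_Ici hy hy
      have h2 := mul_nonneg hy (besselFun_bounds n y).1
      linarith
  simpa using hbdd.neg.div_const (2 * ((n : ℝ) + 1))

lemma integral_Ioi_besselFun (n : ℕ) (x : ℝ) :
    IntegrableOn (fun y => besselFun n y * Real.exp (-|x - y|)) (Set.Ioi x) ∧
      ∫ y in Set.Ioi x, besselFun n y * Real.exp (-|x - y|) =
        (besselFun (n + 1) x - x * besselFun n x) / (2 * (n + 1)) := by
  have hderiv (y : ℝ) (_ : y ∈ Set.Ici x) :
      HasDerivAt (fun y => -(Real.exp (x - y) * (besselFun (n + 1) y - y * besselFun n y))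
        / (2 * (n + 1))) (besselFun n y * Real.exp (x - y)) y := by
    obtain ⟨hA, hB⟩ := hasDerivAt_besselFun n y
    refine ((((hasDerivAt_id y).const_sub x).exp.mul (hA.sub hB)).neg.div_const
      (2 * ((n : ℝ) + 1))).congr_deriv ?_
    simp only [id, Pi.sub_apply]
    field_simp
    ring
  have hnonneg (y : ℝ) (_ : y ∈ Set.Ioi x) : 0 ≤ besselFun n y * Real.exp (x - y) :=
    mul_nonneg (besselFun_bounds n y).1 (Real.exp_pos _).le
  have heq : Set.EqOn (fun y => besselFun n y * Real.exp (-|x - y|))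
      (fun y => besselFun n y * Real.exp (x - y)) (Set.Ioi x) := by
    intro y hy
    have h : x - y < 0 := sub_neg.2 (Set.mem_Ioi.1 hy)
    simp only [abs_of_neg h, neg_neg]
  have hlim := tendsto_exp_mul_besselFun n x
  refine ⟨(integrableOn_congr_fun heq measurableSet_Ioi).2
    (integrableOn_Ioi_deriv_of_nonneg' hderiv hnonneg hlim), ?_⟩
  rw [setIntegral_congr_fun measurableSet_Ioi heq,
    integral_Ioi_of_hasDerivAt_of_nonneg' hderiv hnonneg hlim]
  simp
  ring

/-- Convolving with `e^{-|x|}` raises the index of `besselFun`. -/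
lemma integral_besselFun_conv (n : ℕ) (x : ℝ) :
    Integrable (fun y => besselFun n y * Real.exp (-|x - y|)) ∧
      ∫ y, besselFun n y * Real.exp (-|x - y|) = besselFun (n + 1) x / (n + 1) := by
  obtain ⟨hi, hv⟩ := integral_Ioi_besselFun n x
  obtain ⟨hi', hv'⟩ := integral_Ioi_besselFun n (-x)
  have hsymm : (fun y => besselFun n y * Real.exp (-|x - y|)) =
      fun y => (fun z => besselFun n z * Real.exp (-|-x - z|)) (-y) := by
    ext y
    simp only [besselFun_neg]
    rw [show -x - -y = -(x - y) by ring, abs_neg]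
  have hIic : IntegrableOn (fun y => besselFun n y * Real.exp (-|x - y|)) (Set.Iic x) := by
    rw [integrableOn_Iic_iff_integrableOn_Iio, hsymm]
    have := (Measure.measurePreserving_neg (volume : Measure ℝ)).integrableOn_comp_preimage
      (Homeomorph.neg ℝ).measurableEmbedding (s := Set.Ioi (-x))
      (f := fun z => besselFun n z * Real.exp (-|-x - z|))
    simpa [Function.comp_def] using this.2 hi'
  refine ⟨integrableOn_univ.1 (Set.Iic_union_Ioi (a := x) ▸ hIic.union hi), ?_⟩
  rw [← intervalIntegral.integral_Iic_add_Ioi hIic hi, hv]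
  have : ∫ y in Set.Iic x, besselFun n y * Real.exp (-|x - y|) =
      (besselFun (n + 1) x + x * besselFun n x) / (2 * (n + 1)) := by
    rw [hsymm, integral_comp_neg_Iic x (fun z => besselFun n z * Real.exp (-|-x - z|)), hv', besselFun_neg, besselFun_neg]
    ring
  rw [this]
  field_simp
  ring

lemma integral_besselFun_conv_scaled {μ : ℝ} (hμ : 0 < μ) (n : ℕ) (x : ℝ) :
    Integrable (fun y => besselFun n (μ * (x - y)) * Real.exp (-μ * |y|)) ∧
      ∫ y, besselFun n (μ * (x - y)) * Real.exp (-μ * |y|) =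
        besselFun (n + 1) (μ * x) / (μ * (n + 1)) := by
  obtain ⟨hi, hv⟩ := integral_besselFun_conv n (μ * x)
  have heq : (fun y => besselFun n (μ * (x - y)) * Real.exp (-μ * |y|)) =
      fun y => (fun z => (fun w => besselFun n w * Real.exp (-|μ * x - w|)) (μ * z)) (x - y) := by
    ext y
    simp only
    rw [show μ * x - μ * (x - y) = μ * y by ring, abs_mul, abs_of_pos hμ, neg_mul]
  rw [heq]
  refine ⟨(hi.comp_mul_left' hμ.ne').comp_sub_left x, ?_⟩
  rw [integral_sub_left_eq_self
    (fun z => (fun w => besselFun n w * Real.exp (-|μ * x - w|)) (μ * z)) volume x,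
    Measure.integral_comp_mul_left (fun w => besselFun n w * Real.exp (-|μ * x - w|)) μ, hv, abs_of_pos (inv_pos.2 hμ), smul_eq_mul]
  field_simp

lemma norm_convIter_le {μ C : ℝ} (hμ : 0 < μ) (hC : 0 ≤ C) {f : ℝ → ℂ}
    (hbd : ∀ ξ : ℝ, ‖f ξ‖ ≤ C * Real.exp (-μ * |ξ|)) (n : ℕ) (ξ : ℝ) :
    ‖convIter f n ξ‖ ≤ C ^ (n + 1) / (μ ^ n * n.factorial) * besselFun n (μ * ξ) := by
  induction n generalizing ξ with
  | zero => simpa [convIter, besselFun, abs_mul, abs_of_pos hμ] using hbd ξ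
  | succ n ih =>
    obtain ⟨hi, hv⟩ := integral_besselFun_conv_scaled hμ n ξ
    set K : ℝ := C ^ (n + 1) / (μ ^ n * n.factorial) with hK
    have hK0 : 0 ≤ K := by positivity
    calc ‖convIter f (n + 1) ξ‖
        ≤ ∫ η, ‖convIter f n (ξ - η) * f η‖ := norm_integral_le_integral_norm _
      _ ≤ ∫ η, K * C * (besselFun n (μ * (ξ - η)) * Real.exp (-μ * |η|)) := by
        refine integral_mono_of_nonneg (ae_of_all _ fun _ => norm_nonneg _) (hi.const_mul _)
          (ae_of_all _ fun η => ?_)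
        simp only [norm_mul]
        calc _ ≤ (K * besselFun n (μ * (ξ - η))) * (C * Real.exp (-μ * |η|)) :=
              mul_le_mul (ih _) (hbd η) (norm_nonneg _)
                (mul_nonneg hK0 (besselFun_bounds _ _).1)
          _ = _ := by ring
      _ = _ := by
        rw [integral_const_mul, hv, hK, Nat.factorial_succ]
        push_cast
        field_simp
        ring

lemma besselFun_le_prod (n : ℕ) (x : ℝ) :
    besselFun n x ≤
      2 ^ n * (∏ k ∈ Finset.range n, ((1 + |x|) / 2 + k)) * Real.exp (-|x|) := by
  induction n with
  | zero => simp [besselFun]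
  | succ n ih =>
    refine (besselFun_bounds n x).2.2.trans
      ((mul_le_mul_of_nonneg_left ih (by positivity)).trans_eq ?_)
    rw [Finset.prod_range_succ]
    ring

lemma Gamma_add_nat_div_Gamma {a : ℝ} (ha : 0 < a) (n : ℕ) :
    Real.Gamma (a + n) / Real.Gamma a = ∏ k ∈ Finset.range n, (a + k) := by
  induction n with
  | zero => simp [(Real.Gamma_pos_of_pos ha).ne']
  | succ n ih =>
    rw [Finset.prod_range_succ, ← ih]
    push_cast
    rw [← add_assoc, Real.Gamma_add_one (by positivity)]
    ring

lemma kummer_term_eq {a : ℝ} (ha : 0 < a) (z : ℝ) (n : ℕ) :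
    (Real.Gamma (a + n) / Real.Gamma a) / (Real.Gamma (2 + n) / Real.Gamma 2)
      * z ^ n / (n.factorial : ℝ) =
    (∏ k ∈ Finset.range n, (a + k)) / (n + 1).factorial * z ^ n / n.factorial := by
  have h2 : Real.Gamma (2 + n) = (n + 1).factorial := by
    rw [← Real.Gamma_nat_eq_factorial]
    congr 1
    push_cast
    ring
  rw [Gamma_add_nat_div_Gamma ha, h2, Real.Gamma_two, div_one]

lemma hasSum_kummerM {a z : ℝ} (ha : 0 < a) (hz : 0 ≤ z) :
    HasSum (fun n : ℕ => (∏ k ∈ Finset.range n, (a + k)) / (n + 1).factorial * z ^ n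
      / n.factorial) (kummerM a 2 z) := by
  have hprod (n : ℕ) : ∏ k ∈ Finset.range n, (a + k) ≤ (a + 1) ^ n * (n + 1).factorial := by
    induction n with
    | zero => simp
    | succ n ih =>
      rw [Finset.prod_range_succ, Nat.factorial_succ (n + 1)]
      calc _ ≤ ((a + 1) ^ n * (n + 1).factorial) * ((a + 1) * ((n + 1 : ℕ) + 1 : ℝ)) := by
            gcongr
            push_cast
            nlinarith [(Nat.cast_nonneg n : (0 : ℝ) ≤ n)]
        _ = _ := by push_cast; ring
  have hs : Summable (fun n : ℕ => (∏ k ∈ Finset.range n, (a + k)) / (n + 1).factorial * z ^ n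
      / n.factorial) := by
    refine Summable.of_nonneg_of_le (fun n => ?_) (fun n => ?_)
      (Real.summable_pow_div_factorial ((a + 1) * z))
    · have := Finset.prod_nonneg (s := Finset.range n) (f := fun k : ℕ => a + k)
        (fun k _ => by positivity)
      positivity
    · rw [mul_pow]
      gcongr
      rw [div_le_iff₀ (by positivity)]
      exact hprod n
  rw [kummerM]
  simp_rw [kummer_term_eq ha]
  exact hs.hasSum

/-- Remark after Lemma `spectrum:S2`: the sharper bound for `exp₂*[f]`
in terms of Kummer's confluent hypergeometric function. -/
theorem stmt_5
    (μ C : ℝ) (hμ : 0 < μ) (hC : 0 ≤ C)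
    (f : ℝ → ℂ) (hf : Integrable f)
    (hbd : ∀ ξ : ℝ, ‖f ξ‖ ≤ C * Real.exp (-μ * |ξ|)) :
    ∀ ξ : ℝ, ‖exp2star f ξ‖ ≤
      C * Real.exp (-μ * |ξ|) *
        (kummerM ((1 + μ * |ξ|) / 2) 2 (C / (Real.pi * μ)) - 1) := by
  intro ξ
  have ht : 0 ≤ μ * |ξ| := by positivity
  have hsum := (hasSum_nat_add_iff' 1).2 (hasSum_kummerM (a := (1 + μ * |ξ|) / 2)
    (z := C / (Real.pi * μ)) (by positivity) (by positivity))
  simp only [Finset.range_one, Finset.sum_singleton, Finset.range_zero, Finset.prod_empty,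
    zero_add, Nat.factorial_one, Nat.factorial_zero, Nat.cast_one, pow_zero, div_one,
    mul_one] at hsum
  refine tsum_of_norm_bounded (hsum.mul_left (C * Real.exp (-μ * |ξ|))) fun n => ?_
  have hπ := Real.pi_pos
  have hb := besselFun_le_prod (n + 1) (μ * ξ)
  rw [abs_mul, abs_of_pos hμ] at hb
  have hconv := (norm_convIter_le hμ hC hbd (n + 1) ξ).trans
    (mul_le_mul_of_nonneg_left hb (by positivity))
  rw [norm_div, norm_mul, norm_pow, Complex.norm_natCast, Complex.norm_real, Real.norm_eq_abs,
    abs_of_pos (by positivity : 0 < 2 * Real.pi)]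
  refine (div_le_div_of_nonneg_right hconv (by positivity)).trans_eq ?_
  rw [neg_mul, div_pow, mul_pow, mul_pow]
  field_simp
  ring

end
end
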